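/- Let K be a field and let L be a subfield of K^solv containing K with [L : K] finite. If O' is a solv-henselian valuation ring of L whose residue field is not solv-closed, then O' ∩ K is a solv-henselian valuation ring of K whose residue field is not solv-closed. -/

import Mathlib

noncomputable section

/-- The maximal solvable extension of `K` inside an ambient field extension `Ω`:
the compositum of all finite Galois subextensions of `Ω/K` with solvable Galois group. -/
def maxSolvableExt (K Ω : Type*) [Field K] [Field Ω] [Algebra K Ω] :
    IntermediateField K Ω :=
  ⨆ L : {L : IntermediateField K Ω //
      FiniteDimensional K ↥L ∧ IsGalois K ↥L ∧ IsSolvable (↥L ≃ₐ[K] ↥L)}, L.1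

/-- `K^solv`, the maximal solvable extension of `K` (inside a fixed algebraic closure). -/
abbrev solvClosure (K : Type*) [Field K] : IntermediateField K (AlgebraicClosure K) :=
  maxSolvableExt K (AlgebraicClosure K)

/-- A valuation (subring) of `K` is solv-henselian if it extends uniquely to `K^solv`. -/
def IsSolvHenselian {K : Type*} [Field K] (O : ValuationSubring K) : Prop :=
  ∃! O' : ValuationSubring ↥(solvClosure K),
    O'.comap (algebraMap K ↥(solvClosure K)) = O

/-- A field is solv-closed if it admits no nontrivial finite Galois extension with
solvable Galois group. -/
def IsSolvClosed (K : Type*) [Field K] : Prop :=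
  ∀ L : IntermediateField K (AlgebraicClosure K),
    FiniteDimensional K ↥L → IsGalois K ↥L → IsSolvable (↥L ≃ₐ[K] ↥L) → L = ⊥

/-- For every prime `p`, the field is closed under `p`-th roots and contains the `p`-th roots of
unity (if `p` is invertible), or is closed under Artin-Schreier roots (if `p` is zero). -/
structure IsPrimeRadicallyClosed (F : Type*) [Field F] : Prop where
  exists_pow_eq : ∀ p : ℕ, p.Prime → (p : F) ≠ 0 → ∀ a : F, ∃ y, y ^ p = a
  exists_primitiveRoot : ∀ p : ℕ, p.Prime → (p : F) ≠ 0 → ∃ ζ : F, IsPrimitiveRoot ζ p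
  exists_pow_sub_eq : ∀ p : ℕ, p.Prime → (p : F) = 0 → ∀ a : F, ∃ y, y ^ p - y = a

section Automorphism

variable {F : Type*} [Field F]

lemma sum_range_shift {M : Type*} [AddCommGroup M] (f : ℕ → M) (n : ℕ) (h : f n = f 0) :
    ∑ i ∈ Finset.range n, f (i + 1) = ∑ i ∈ Finset.range n, f i := by
  have h1 := Finset.sum_range_succ' f n
  rw [Finset.sum_range_succ, h] at h1
  exact (add_right_cancel h1).symm

lemma map_trace_eq {τ : F ≃+* F} {n : ℕ} {u : F} (hu : τ^[n] u = u) :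
    τ (∑ i ∈ Finset.range n, τ^[i] u) = ∑ i ∈ Finset.range n, τ^[i] u := by
  rw [map_sum, ← sum_range_shift (fun i => τ^[i] u) n (by simpa using hu)]
  simp only [Function.iterate_succ_apply']

lemma map_norm_eq {τ : F ≃+* F} {n : ℕ} {u : F} (hu : τ^[n] u = u) :
    τ (∏ i ∈ Finset.range n, τ^[i] u) = ∏ i ∈ Finset.range n, τ^[i] u := by
  rcases eq_or_ne u 0 with rfl | hu0
  · simp
  have h1 := Finset.prod_range_succ' (fun i => τ^[i] u) n
  rw [Finset.prod_range_succ, hu, Function.iterate_zero_apply] at h1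
  rw [map_prod, mul_right_cancel₀ hu0 h1]
  simp only [Function.iterate_succ_apply']

lemma exists_weighted_trace_ne_zero {p : ℕ} (hp : p.Prime) {τ : F ≃+* F} {x : F}
    (hx : τ^[p] x = x) (hτ : τ x ≠ x) {c : ℕ → F} (hc : c 0 ≠ 0) :
    ∃ u, τ^[p] u = u ∧ ∑ i ∈ Finset.range p, c i * τ^[i] u ≠ 0 := by
  by_contra! H
  have : Fact p.Prime := ⟨hp⟩
  have hmin : Function.minimalPeriod τ x = p := Function.minimalPeriod_eq_prime hx hτ
  have hinj : Function.Injective (fun i : Fin p => τ^[i] x) := by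
    intro i j hij
    have := Function.iterate_injOn_Iio_minimalPeriod (f := τ) (x := x)
    rw [hmin] at this
    exact Fin.ext (this i.2 j.2 hij)
  have hv : (fun i : Fin p => c i) = 0 := by
    refine Matrix.eq_zero_of_forall_pow_sum_mul_pow_eq_zero hinj fun k => ?_
    have := H (x ^ (k : ℕ)) (by rw [iterate_map_pow, hx])
    rw [Finset.sum_range] at this
    simpa [iterate_map_pow] using this
  exact hc (congrFun hv ⟨0, hp.pos⟩)

lemma exists_kummer_generator {p : ℕ} (hp : p.Prime) {τ : F ≃+* F} {x ζ : F}
    (hx : τ^[p] x = x) (hτ : τ x ≠ x) (hζ : IsPrimitiveRoot ζ p) (hτζ : τ ζ = ζ) :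
    ∃ y, y ≠ 0 ∧ τ^[p] y = y ∧ τ y = ζ * y := by
  obtain ⟨u, hu, hs⟩ := exists_weighted_trace_ne_zero hp hx hτ (c := fun i => (ζ⁻¹) ^ i) (by simp)
  have hζ0 : ζ ≠ 0 := hζ.ne_zero hp.ne_zero
  have hfix : ∀ i, τ^[i] ζ = ζ := fun i => Function.iterate_fixed hτζ i
  refine ⟨_, hs, ?_, ?_⟩
  · rw [← RingAut.coe_pow, map_sum]
    refine Finset.sum_congr rfl fun i _ => ?_
    rw [map_mul, map_pow, map_inv₀, RingAut.coe_pow, hfix,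
      ← Function.iterate_add_apply, add_comm p i, Function.iterate_add_apply, hu]
  · rw [map_sum, ← sum_range_shift (fun i => ζ⁻¹ ^ i * τ^[i] u) p, Finset.mul_sum]
    · refine Finset.sum_congr rfl fun i _ => ?_
      rw [map_mul, map_pow, map_inv₀, hτζ, Function.iterate_succ_apply', pow_succ]
      field_simp
    · simp [hu, hζ.pow_eq_one]

lemma exists_trace_eq_one {p : ℕ} (hp : p.Prime) {τ : F ≃+* F} {x : F}
    (hx : τ^[p] x = x) (hτ : τ x ≠ x) :
    ∃ u, τ^[p] u = u ∧ ∑ i ∈ Finset.range p, τ^[i] u = 1 := by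
  obtain ⟨u, hu, hs⟩ := exists_weighted_trace_ne_zero hp hx hτ (c := fun _ => 1) (by simp)
  simp only [one_mul] at hs
  set t := ∑ i ∈ Finset.range p, τ^[i] u with ht
  have hτt : τ t = t := map_trace_eq hu
  refine ⟨u / t, ?_, ?_⟩
  · rw [← RingAut.coe_pow, map_div₀, RingAut.coe_pow, hu, Function.iterate_fixed hτt]
  · rw [← div_self hs, ht, Finset.sum_div]
    refine Finset.sum_congr rfl fun i _ => ?_
    rw [← ht, ← RingAut.coe_pow, map_div₀, RingAut.coe_pow, Function.iterate_fixed hτt]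

lemma exists_artinSchreier_generator {p : ℕ} (hp : p.Prime) (hpF : (p : F) = 0) {τ : F ≃+* F}
    {x : F} (hx : τ^[p] x = x) (hτ : τ x ≠ x) :
    ∃ y, τ^[p] y = y ∧ τ y = y + 1 := by
  obtain ⟨u, hu, hs⟩ := exists_trace_eq_one hp hx hτ
  refine ⟨- ∑ i ∈ Finset.range p, (i : F) * τ^[i] u, ?_, ?_⟩
  · rw [← RingAut.coe_pow, map_neg, map_sum]
    congr 1
    refine Finset.sum_congr rfl fun i _ => ?_
    rw [map_mul, RingAut.coe_pow, ← RingAut.coe_pow, map_natCast, RingAut.coe_pow,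
      ← Function.iterate_add_apply, add_comm p i, Function.iterate_add_apply, hu]
  · have h := sum_range_shift (fun i => (i : F) * τ^[i] u) p (by simp [hpF])
    have h' := sum_range_shift (fun i => τ^[i] u) p (by simpa using hu)
    simp only [Nat.cast_add, Nat.cast_one, add_mul, one_mul, Finset.sum_add_distrib, h', hs] at h
    rw [map_neg, map_sum, ← h]
    simp only [map_mul, map_natCast, Function.iterate_succ_apply']
    ring

lemma pow_ne_of_kummer {p : ℕ} (hp : p.Prime) {τ : F ≃+* F} {ζ y t : F}
    (hζ : IsPrimitiveRoot ζ p) (hτζ : τ ζ = ζ) (hy : y ≠ 0) (hτy : τ y = ζ * y) (ht : τ t = t) :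
    t ^ p ≠ y ^ p := by
  intro h
  have hd : (t / y) ^ p = 1 := by rw [div_pow, h, div_self (pow_ne_zero _ hy)]
  have : NeZero p := ⟨hp.ne_zero⟩
  obtain ⟨j, -, hj⟩ := hζ.eq_pow_of_pow_eq_one hd
  have hζ0 : ζ ≠ 0 := hζ.ne_zero hp.ne_zero
  have h1 : t = ζ ^ j * y := by rw [hj, div_mul_cancel₀ _ hy]
  have h2 : τ t = ζ * t := by rw [h1, map_mul, map_pow, hτζ, hτy]; ring
  rw [ht] at h2
  have ht0 : t ≠ 0 := by rw [h1]; positivity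
  exact hζ.ne_one hp.one_lt (mul_right_cancel₀ ht0 (by rw [← h2, one_mul]))

lemma exists_intCast_of_pow_eq_self {p : ℕ} (hp : p.Prime) (hpF : (p : F) = 0) {d : F}
    (hd : d ^ p = d) : ∃ j : ℤ, (j : F) = d := by
  have : Fact p.Prime := ⟨hp⟩
  have : CharP F p := (CharP.charP_iff_prime_eq_zero hp).2 hpF
  exact (mem_bot_iff_intCast p F).1 ((Subfield.mem_bot_iff_pow_eq_self F p).2 hd)

lemma pow_sub_ne_of_artinSchreier {p : ℕ} (hp : p.Prime) (hpF : (p : F) = 0) {τ : F ≃+* F}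
    {y t : F} (hτy : τ y = y + 1) (ht : τ t = t) : t ^ p - t ≠ y ^ p - y := by
  intro h
  have : Fact p.Prime := ⟨hp⟩
  have : CharP F p := (CharP.charP_iff_prime_eq_zero hp).2 hpF
  obtain ⟨j, hj⟩ := exists_intCast_of_pow_eq_self hp hpF (d := y - t)
    (by rw [sub_pow_char]; linear_combination -h)
  have h2 := congrArg τ hj
  rw [map_intCast, map_sub, hτy, ht, hj] at h2
  exact one_ne_zero (α := F) (by linear_combination -h2)

end Automorphism

namespace IsPrimeRadicallyClosed

variable {F : Type*} [Field F] (hF : IsPrimeRadicallyClosed F)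
include hF

lemma exists_fixed_primitiveRoot {p : ℕ} (hp : p.Prime) (hpF : (p : F) ≠ 0) (τ : F ≃+* F) :
    ∃ ζ, IsPrimitiveRoot ζ p ∧ τ^[p - 1] ζ = ζ := by
  obtain ⟨ζ, hζ⟩ := hF.exists_primitiveRoot p hp hpF
  have : NeZero p := ⟨hp.ne_zero⟩
  obtain ⟨m, -, hm⟩ := hζ.eq_pow_of_pow_eq_one (ξ := τ ζ) (by rw [← map_pow, hζ.pow_eq_one, map_one])
  have hcop : m.Coprime p := by
    have : IsPrimitiveRoot (ζ ^ m) p := by rw [hm]; exact hζ.map_of_injective τ.injective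
    exact (hζ.pow_iff_coprime hp.pos m).1 this
  refine ⟨ζ, hζ, ?_⟩
  have hiter : ∀ k, τ^[k] ζ = ζ ^ (m ^ k) := by
    intro k
    induction k with
    | zero => simp
    | succ k ih => rw [Function.iterate_succ_apply', ih, map_pow, ← hm, ← pow_mul, pow_succ, mul_comm]
  rw [hiter]
  have h1 : m ^ (p - 1) ≡ 1 [MOD p] := by
    have := Nat.ModEq.pow_totient hcop
    rwa [Nat.totient_prime hp] at this
  rw [pow_eq_pow_of_modEq h1 hζ.pow_eq_one, pow_one]

/-- An automorphism of finite order of a prime-radically closed field which fixes a square root of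
`-1` is trivial. -/
lemma eq_one_of_pow_eq_one {τ : F ≃+* F} {n : ℕ} (hn : n ≠ 0)
    (hτn : ∀ x, τ^[n] x = x) {i : F} (hi : i ^ 2 = -1) (hτi : τ i = i) (x : F) : τ x = x := by
  by_contra hx
  let σ : RingAut F := τ
  have hne : σ ≠ 1 := fun h => hx (by simpa using congrArg (fun s : RingAut F => s x) h)
  have hfin : IsOfFinOrder σ := by
    refine isOfFinOrder_iff_pow_eq_one.2 ⟨n, Nat.pos_of_ne_zero hn, ?_⟩
    ext z
    rw [RingAut.coe_pow]
    exact hτn z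
  obtain ⟨p, hp, hpn⟩ := Nat.exists_prime_and_dvd (mt orderOf_eq_one_iff.1 hne)
  have hord : orderOf (σ ^ (orderOf σ / p)) = p :=
    orderOf_pow_orderOf_div hfin.orderOf_pos.ne' hpn
  obtain ⟨ρ, hρ, hρi⟩ : ∃ ρ : RingAut F, orderOf ρ = p ∧ ρ i = i :=
    ⟨_, hord, by rw [RingAut.coe_pow]; exact Function.iterate_fixed hτi _⟩
  have hρp : ∀ x, ρ^[p] x = x := fun x => by
    rw [← RingAut.coe_pow, ← hρ, pow_orderOf_eq_one, RingAut.one_apply]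
  obtain ⟨z, hz⟩ : ∃ z, ρ z ≠ z := by
    by_contra! h
    have : ρ = 1 := by ext z; exact h z
    rw [this, orderOf_one] at hρ
    exact hp.one_lt.ne hρ
  by_cases hpF : (p : F) = 0
  · obtain ⟨y, -, hy⟩ := exists_artinSchreier_generator hp hpF (hρp z) hz
    obtain ⟨u, hu, hu1⟩ := exists_trace_eq_one hp (hρp z) hz
    have : Fact p.Prime := ⟨hp⟩
    have : CharP F p := (CharP.charP_iff_prime_eq_zero hp).2 hpF
    set a := y ^ p - y with ha
    have hρa : ρ a = a := by
      rw [ha, map_sub, map_pow, hy, add_pow_char, one_pow]; ring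
    obtain ⟨w, hw⟩ := hF.exists_pow_sub_eq p hp hpF (a * u)
    refine pow_sub_ne_of_artinSchreier hp hpF hy (map_trace_eq (hρp w)) ?_
    rw [sum_pow_char, ← Finset.sum_sub_distrib, ← ha]
    simp_rw [← iterate_map_pow, ← RingAut.coe_pow, ← map_sub, hw, map_mul, RingAut.coe_pow,
      Function.iterate_fixed hρa, ← Finset.mul_sum, hu1, mul_one]
  · obtain ⟨ζ, hζ, hρζ⟩ : ∃ ζ, IsPrimitiveRoot ζ p ∧ ρ ζ = ζ := by
      obtain ⟨ζ, hζ, h⟩ := hF.exists_fixed_primitiveRoot hp hpF ρ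
      refine ⟨ζ, hζ, ?_⟩
      have := hρp ζ
      rwa [← Nat.sub_add_cancel hp.one_le, Function.iterate_succ_apply', h] at this
    obtain ⟨y, hy0, -, hy⟩ := exists_kummer_generator hp (hρp z) hz hζ hρζ
    obtain ⟨w, hw⟩ := hF.exists_pow_eq p hp hpF y
    have hiter : ∀ k, ρ^[k] y = ζ ^ k * y := by
      intro k
      induction k with
      | zero => simp
      | succ k ih => rw [Function.iterate_succ_apply', ih, map_mul, map_pow, hρζ, hy, pow_succ,
          mul_assoc]
    set t := ∏ k ∈ Finset.range p, ρ^[k] w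
    have htp : t ^ p = ζ ^ (∑ k ∈ Finset.range p, k) * y ^ p := by
      rw [← Finset.prod_pow]
      simp_rw [← iterate_map_pow, hw, hiter]
      rw [Finset.prod_mul_distrib, Finset.prod_pow_eq_pow_sum]
      simp
    have hρt : ρ t = t := map_norm_eq (hρp w)
    rcases hp.eq_two_or_odd' with rfl | hodd
    · refine pow_ne_of_kummer hp (t := i * t) hζ hρζ hy0 hy (by rw [map_mul, hρi, hρt]) ?_
      have : ζ = -1 := hζ.eq_neg_one_of_two_right
      rw [mul_pow, htp, hi, this]
      simp [Finset.sum_range_succ]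
    · refine pow_ne_of_kummer hp hζ hρζ hy0 hy hρt ?_
      rw [htp, Finset.sum_range_id]
      obtain ⟨m, hm⟩ := hodd
      have : p * (p - 1) / 2 = p * m := by
        rw [hm, Nat.add_sub_cancel, mul_left_comm, Nat.mul_div_cancel_left _ two_pos]
      rw [this, pow_mul, hζ.pow_eq_one, one_pow, one_mul]

end IsPrimeRadicallyClosed

section StableValuation

variable {F : Type*} [Field F] {V : ValuationSubring F} {τ : F ≃+* F}

lemma valuation_map_le_iff (hτ : ∀ x, τ x ∈ V ↔ x ∈ V) {x y : F} :
    V.valuation (τ x) ≤ V.valuation (τ y) ↔ V.valuation x ≤ V.valuation y := by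
  simp only [ValuationSubring.valuation_le_iff]
  constructor
  · rintro ⟨a, ha⟩
    refine ⟨⟨τ.symm a, by rw [← hτ, τ.apply_symm_apply]; exact a.2⟩, τ.injective ?_⟩
    simpa using ha
  · rintro ⟨a, rfl⟩
    exact ⟨⟨τ a, (hτ _).2 a.2⟩, (map_mul _ _ _).symm⟩

lemma valuation_map_lt_iff (hτ : ∀ x, τ x ∈ V ↔ x ∈ V) {x y : F} :
    V.valuation (τ x) < V.valuation (τ y) ↔ V.valuation x < V.valuation y := by
  rw [← not_le, valuation_map_le_iff hτ, not_le]

lemma valuation_map_lt_one_iff (hτ : ∀ x, τ x ∈ V ↔ x ∈ V) {x : F} :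
    V.valuation (τ x) < 1 ↔ V.valuation x < 1 := by
  simpa using valuation_map_lt_iff hτ (x := x) (y := 1)

lemma iterate_mem_iff (hτ : ∀ x, τ x ∈ V ↔ x ∈ V) (n : ℕ) (x : F) : τ^[n] x ∈ V ↔ x ∈ V := by
  induction n with
  | zero => rfl
  | succ n ih => rw [Function.iterate_succ_apply', hτ, ih]

lemma ValuationSubring.exists_valuation_lt_one (hV : V ≠ ⊤) : ∃ μ, μ ≠ 0 ∧ V.valuation μ < 1 := by
  obtain ⟨x, hx⟩ : ∃ x, x ∉ V := by
    by_contra! h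
    exact hV (top_le_iff.1 fun x _ => h x)
  have hx1 : 1 < V.valuation x := by rwa [← not_le, V.valuation_le_one_iff]
  have hx0 : x ≠ 0 := by rintro rfl; exact hx V.zero_mem
  refine ⟨x⁻¹, inv_ne_zero hx0, ?_⟩
  rw [map_inv₀]
  exact inv_lt_one_of_one_lt₀ hx1

lemma ValuationSubring.exists_valuation_lt_one_and_lt (hV : V ≠ ⊤) {δ : F} (hδ : δ ≠ 0) :
    ∃ μ, μ ≠ 0 ∧ V.valuation μ < 1 ∧ V.valuation μ < V.valuation δ := by
  obtain ⟨μ, hμ0, hμ⟩ := V.exists_valuation_lt_one hV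
  rcases le_total (V.valuation δ) 1 with h | h
  · have : V.valuation (μ * δ) < V.valuation δ := by
      rw [map_mul]
      exact mul_lt_of_lt_one_left (by simpa [zero_lt_iff] using hδ) hμ
    exact ⟨μ * δ, mul_ne_zero hμ0 hδ, this.trans_le h, this⟩
  · exact ⟨μ, hμ0, hμ, hμ.trans_le h⟩

lemma exists_fixed_approximation {V V' : ValuationSubring F} (hV : V ≠ ⊤) (hV' : V' ≠ ⊤)
    (hind : ∀ z : F, ∃ v ∈ V, ∃ v' ∈ V', z = v * v')
    (hτV : ∀ x, τ x ∈ V ↔ x ∈ V) (hτV' : ∀ x, τ x ∈ V' ↔ x ∈ V')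
    (hfin : ∀ x, ∃ n ≠ 0, τ^[n] x = x) {δ δ' : F} (hδ : δ ≠ 0) (hδ' : δ' ≠ 0)
    (hτδ' : τ δ' = δ') :
    ∃ e, τ e = e ∧ V.valuation e < V.valuation δ ∧ V'.valuation (1 - e) < V'.valuation δ' := by
  obtain ⟨μ, hμ0, hμ, hμδ⟩ := V.exists_valuation_lt_one_and_lt hV hδ
  obtain ⟨μ', hμ'0, hμ', hμδ'⟩ := V'.exists_valuation_lt_one_and_lt hV' hδ'
  obtain ⟨v, hv, v', hv', hvv⟩ := hind (μ * μ')⁻¹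
  set c := μ * v with hc
  set d := μ' * v' with hd
  have hcd : c * d = 1 := by
    rw [hc, hd, mul_mul_mul_comm, ← hvv]
    exact mul_inv_cancel₀ (mul_ne_zero hμ0 hμ'0)
  have hcV : V.valuation c ≤ V.valuation μ := by
    rw [hc, map_mul]
    exact mul_le_of_le_one_right' ((V.valuation_le_one_iff v).2 hv)
  have hdV : V'.valuation d ≤ V'.valuation μ' := by
    rw [hd, map_mul]
    exact mul_le_of_le_one_right' ((V'.valuation_le_one_iff v').2 hv')
  have hc1 : V.valuation (1 + c) = 1 := Valuation.map_one_add_of_lt _ (hcV.trans_lt hμ)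
  have hd1 : V'.valuation (1 + d) = 1 := Valuation.map_one_add_of_lt _ (hdV.trans_lt hμ')
  have hc0 : 1 + c ≠ 0 := fun h => by simp [h] at hc1
  have hd0 : 1 + d ≠ 0 := fun h => by simp [h] at hd1
  set e := c / (1 + c) with he
  have hev : V.valuation e = V.valuation c := by rw [he, map_div₀, hc1, div_one]
  have he' : 1 - e = d / (1 + d) := by
    rw [he]
    field_simp
    linear_combination -hcd
  have hev' : V'.valuation (1 - e) = V'.valuation d := by rw [he', map_div₀, hd1, div_one]
  obtain ⟨n, hn, hne⟩ := hfin e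
  have hV'e : ∀ i, V'.valuation (1 - τ^[i] e) < 1 ∧ V'.valuation (1 - τ^[i] e) < V'.valuation δ' := by
    intro i
    induction i with
    | zero =>
      rw [Function.iterate_zero_apply, hev']
      exact ⟨hdV.trans_lt hμ', hdV.trans_lt hμδ'⟩
    | succ i ih =>
      have : 1 - τ^[i + 1] e = τ (1 - τ^[i] e) := by
        rw [map_sub, map_one, Function.iterate_succ_apply']
      rw [this]
      exact ⟨(valuation_map_lt_one_iff hτV').2 ih.1, by
        rw [← hτδ', valuation_map_lt_iff hτV']; exact ih.2⟩
  refine ⟨∏ i ∈ Finset.range n, τ^[i] e, map_norm_eq hne, ?_, ?_⟩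
  · obtain ⟨m, rfl⟩ := Nat.exists_eq_succ_of_ne_zero hn
    rw [Finset.prod_range_succ', Function.iterate_zero_apply, map_mul]
    refine (mul_le_of_le_one_left' ?_).trans_lt (hev.trans_le hcV |>.trans_lt hμδ)
    rw [V.valuation_le_one_iff]
    refine prod_mem fun i _ => (iterate_mem_iff hτV _ _).2 ?_
    rw [← V.valuation_le_one_iff, hev]
    exact (hcV.trans_lt hμ).le
  · have hmem : ∀ i, τ^[i] e ∈ V' := by
      intro i
      have h := V'.mem_of_valuation_le_one _ (hV'e i).1.le
      simpa using sub_mem V'.one_mem h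
    have key : ∀ k, V'.valuation (1 - ∏ i ∈ Finset.range k, τ^[i] e) < V'.valuation δ' := by
      intro k
      induction k with
      | zero => simpa [zero_lt_iff] using hδ'
      | succ k ih =>
        rw [Finset.prod_range_succ]
        have : 1 - (∏ i ∈ Finset.range k, τ^[i] e) * τ^[k] e =
            (1 - ∏ i ∈ Finset.range k, τ^[i] e) +
              (∏ i ∈ Finset.range k, τ^[i] e) * (1 - τ^[k] e) := by ring
        rw [this]
        refine Valuation.map_add_lt _ ih ?_
        rw [map_mul]
        refine (mul_le_of_le_one_left' ?_).trans_lt (hV'e k).2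
        rw [V'.valuation_le_one_iff]
        exact prod_mem fun i _ => hmem i
    exact key n

namespace IsPrimeRadicallyClosed

variable (hF : IsPrimeRadicallyClosed F)
include hF

lemma exists_fixed_pow_eq {p : ℕ} (hp : p.Prime) (hτ : ∀ x, τ x ∈ V ↔ x ∈ V) {ζ : F}
    (hpF : (p : F) ≠ 0) (hζ : IsPrimitiveRoot ζ p) (hτζ : τ ζ = ζ) {u : F} (hτu : τ u = u)
    (hu : V.valuation (u - 1) <
      V.valuation ((∏ k ∈ Finset.range (p - 1), (ζ ^ (k + 1) - 1)) ^ p)) :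
    ∃ t, t ≠ 0 ∧ τ t = t ∧ t ^ p = u := by
  have hroot : ∀ μ : F, μ ^ p = 1 → V.valuation μ = 1 := fun μ hμ =>
    (pow_eq_one_iff_of_nonneg zero_le hp.ne_zero).1 (by rw [← map_pow, hμ, map_one])
  have : NeZero p := ⟨hp.ne_zero⟩
  obtain ⟨z, hz⟩ := hF.exists_pow_eq p hp hpF u
  set δ := ∏ k ∈ Finset.range (p - 1), (ζ ^ (k + 1) - 1) with hδ
  have hle : ∀ k ∈ Finset.range (p - 1), V.valuation (ζ ^ (k + 1) - 1) ≤ 1 := by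
    intro k _
    rw [V.valuation_le_one_iff]
    refine sub_mem (pow_mem ?_ _) V.one_mem
    rw [← V.valuation_le_one_iff]
    exact (hroot ζ hζ.pow_eq_one).le
  have hδle : ∀ j, j < p → j ≠ 0 → V.valuation δ ≤ V.valuation (ζ ^ j - 1) := by
    intro j hj hj0
    have hmem : j - 1 ∈ Finset.range (p - 1) := by rw [Finset.mem_range]; omega
    rw [hδ, map_prod, ← Finset.mul_prod_erase _ _ hmem, Nat.sub_add_cancel (by omega)]
    exact mul_le_of_le_one_right' (Finset.prod_le_one' fun k hk => hle k (Finset.mem_of_mem_erase hk))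
  have hδ1 : V.valuation δ ≤ 1 := by
    rw [hδ, map_prod]
    exact Finset.prod_le_one' hle
  obtain ⟨μ, hμ, hμz⟩ : ∃ μ ∈ Polynomial.nthRootsFinset p (1 : F), V.valuation (z - μ) < V.valuation δ := by
    by_contra! h
    refine hu.not_ge ?_
    have := hζ.pow_sub_pow_eq_prod_sub_mul z 1 hp.pos
    simp only [one_pow, mul_one, hz] at this
    rw [this, map_prod, map_pow]
    refine le_of_eq_of_le ?_ (Finset.prod_le_prod' h)
    rw [Finset.prod_const, hζ.card_nthRootsFinset]
  have hμ1 : μ ^ p = 1 := (Polynomial.mem_nthRootsFinset hp.pos 1).1 hμ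
  have hμ0 : μ ≠ 0 := by rintro rfl; simp [hp.ne_zero] at hμ1
  set t := z / μ with ht
  have htp : t ^ p = u := by rw [ht, div_pow, hμ1, hz, div_one]
  have ht1 : V.valuation (t - 1) < V.valuation δ := by
    have : t - 1 = (z - μ) / μ := by rw [ht]; field_simp
    rwa [this, map_div₀, hroot μ hμ1, div_one]
  have htv : V.valuation t = 1 := by
    have := Valuation.map_one_add_of_lt V.valuation (ht1.trans_le hδ1)
    rwa [add_sub_cancel] at this
  have ht0 : t ≠ 0 := by intro h; simp [h] at htv
  refine ⟨t, ht0, ?_, htp⟩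
  obtain ⟨j, hj, hjt⟩ := hζ.eq_pow_of_pow_eq_one (ξ := τ t / t)
    (by rw [div_pow, ← map_pow, htp, hτu, div_self]; rw [← htp]; exact pow_ne_zero _ ht0)
  have hτt : τ t = ζ ^ j * t := by rw [hjt, div_mul_cancel₀ _ ht0]
  rcases eq_or_ne j 0 with rfl | hj0
  · simpa using hτt
  have hτδ : τ δ = δ := by simp [hδ, map_prod, hτζ]
  have hτt1 : V.valuation (τ t - 1) < V.valuation δ := by
    have : V.valuation (τ (t - 1)) < V.valuation (τ δ) := (valuation_map_lt_iff hτ).2 ht1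
    rwa [hτδ, map_sub, map_one] at this
  have : V.valuation ((τ t - 1) - (t - 1)) < V.valuation δ := Valuation.map_sub_lt _ hτt1 ht1
  rw [sub_sub_sub_cancel_right, hτt, ← sub_one_mul, map_mul, htv, mul_one] at this
  exact absurd this (hδle j hj hj0).not_gt

lemma exists_fixed_pow_sub_eq {p : ℕ} (hp : p.Prime) (hτ : ∀ x, τ x ∈ V ↔ x ∈ V)
    (hpF : (p : F) = 0) {b : F} (hτb : τ b = b) (hb : V.valuation b < 1) :
    ∃ t, τ t = t ∧ t ^ p - t = b := by
  have : Fact p.Prime := ⟨hp⟩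
  have : CharP F p := (CharP.charP_iff_prime_eq_zero hp).2 hpF
  obtain ⟨z, hz⟩ := hF.exists_pow_sub_eq p hp hpF b
  have hzV : z ∈ V := by
    rw [← V.valuation_le_one_iff]
    by_contra! h
    have h1 : V.valuation (z ^ p) = V.valuation z := by
      rw [show z ^ p = z + b by linear_combination hz]
      exact Valuation.map_add_eq_of_lt_left _ (hb.trans h)
    rw [map_pow] at h1
    exact (lt_self_pow₀ h hp.one_lt).ne' h1
  obtain ⟨j, hj⟩ : ∃ j : ℤ, V.valuation (z - j) < 1 := by
    set r := IsLocalRing.residue V ⟨z, hzV⟩ with hr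
    obtain ⟨j, hj⟩ := exists_intCast_of_pow_eq_self hp (F := IsLocalRing.ResidueField V) (d := r)
      (by have hpV : (p : V) = 0 := Subtype.ext (by simp)
          rw [← map_natCast (IsLocalRing.residue V), hpV, map_zero])
      (by
        rw [← sub_eq_zero, hr, ← map_pow, ← map_sub, IsLocalRing.residue_eq_zero_iff,
          V.valuation_lt_one_iff]
        simpa [hz] using hb)
    refine ⟨j, ?_⟩
    have : IsLocalRing.residue V (⟨z, hzV⟩ - j) = 0 := by
      rw [map_sub, map_intCast, hj, sub_self]
    rw [IsLocalRing.residue_eq_zero_iff, V.valuation_lt_one_iff] at this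
    simpa using this
  refine ⟨z - j, ?_, ?_⟩
  · set d := τ (z - j) - (z - j) with hd
    have hdv : V.valuation d < 1 :=
      Valuation.map_sub_lt _ ((valuation_map_lt_one_iff hτ).2 hj) hj
    have hdp : d ^ p = d := by
      have h1 := congrArg τ hz
      rw [map_sub, map_pow, hτb] at h1
      rw [hd, map_sub, map_intCast, sub_sub_sub_cancel_right, sub_pow_char]
      linear_combination h1 - hz
    by_contra h
    have hd0 : d ≠ 0 := sub_ne_zero.2 h
    have hv0 : V.valuation d ≠ 0 := by simpa using hd0
    have := congrArg V.valuation hdp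
    rw [map_pow] at this
    exact (pow_lt_self_of_lt_one₀ (zero_lt_iff.2 hv0) hdv hp.one_lt).ne this
  · have hjp : (j : F) ^ p = j :=
      (Subfield.mem_bot_iff_pow_eq_self F p).1 ((mem_bot_iff_intCast p F).2 ⟨j, rfl⟩)
    rw [sub_pow_char, hjp, ← hz]; ring

end IsPrimeRadicallyClosed

end StableValuation

section Independent

variable {F : Type*} [Field F]

lemma exists_prime_iterate {α : Type*} {f : α → α} {x : α} (hx : f x ≠ x)
    (hfin : ∃ n ≠ 0, f^[n] x = x) : ∃ p m, p.Prime ∧ f^[m * p] x = x ∧ f^[m] x ≠ x := by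
  obtain ⟨n, hn, hnx⟩ := hfin
  have hpos : 0 < Function.minimalPeriod f x :=
    Function.IsPeriodicPt.minimalPeriod_pos (Nat.pos_of_ne_zero hn) hnx
  obtain ⟨p, hp, m, hm⟩ := Nat.exists_prime_and_dvd
    (fun h => hx (Function.minimalPeriod_eq_one_iff_isFixedPt.1 h))
  refine ⟨p, m, hp, ?_, fun h => ?_⟩
  · rw [mul_comm, ← hm]
    exact Function.iterate_minimalPeriod
  · have hm0 : m ≠ 0 := by rintro rfl; simp [hm] at hpos
    have := Function.IsPeriodicPt.minimalPeriod_le (Nat.pos_of_ne_zero hm0) h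
    rw [hm] at this
    exact this.not_gt (by nlinarith [hp.two_le, Nat.pos_of_ne_zero hm0])

/-- A locally finite automorphism of a prime-radically closed field which stabilizes two nontrivial
independent valuation rings is trivial. -/
lemma IsPrimeRadicallyClosed.map_eq_self_of_independent (hF : IsPrimeRadicallyClosed F)
    {V V' : ValuationSubring F} (hV : V ≠ ⊤) (hV' : V' ≠ ⊤)
    (hind : ∀ z : F, ∃ v ∈ V, ∃ v' ∈ V', z = v * v') {τ : F ≃+* F}
    (hτV : ∀ x, τ x ∈ V ↔ x ∈ V) (hτV' : ∀ x, τ x ∈ V' ↔ x ∈ V')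
    (hfin : ∀ x, ∃ n ≠ 0, τ^[n] x = x) (x : F) : τ x = x := by
  by_contra hx
  obtain ⟨p, m, hp, hmp, hm⟩ := exists_prime_iterate hx (hfin x)
  have coe_iter : ∀ (ρ : F ≃+* F) (k : ℕ), ∃ ρ' : F ≃+* F, ⇑ρ' = ρ^[k] := fun ρ k =>
    ⟨((ρ : RingAut F) ^ k : RingAut F), RingAut.coe_pow _ _⟩
  have hfin_iter : ∀ k x, ∃ n ≠ 0, (τ^[k])^[n] x = x := by
    intro k x
    obtain ⟨n, hn, hnx⟩ := hfin x
    refine ⟨n, hn, ?_⟩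
    rw [← Function.iterate_mul, mul_comm, Function.iterate_mul]
    exact Function.iterate_fixed hnx k
  by_cases hpF : (p : F) = 0
  · obtain ⟨σ, hσ⟩ := coe_iter τ m
    have hσp : σ^[p] x = x := by rwa [hσ, ← Function.iterate_mul]
    have hσx : σ x ≠ x := by rwa [hσ]
    have hσV : ∀ x, σ x ∈ V ↔ x ∈ V := by rw [hσ]; exact iterate_mem_iff hτV m
    have hσV' : ∀ x, σ x ∈ V' ↔ x ∈ V' := by rw [hσ]; exact iterate_mem_iff hτV' m
    have hσfin : ∀ x, ∃ n ≠ 0, σ^[n] x = x := by rw [hσ]; exact hfin_iter m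
    obtain ⟨y, -, hy⟩ := exists_artinSchreier_generator hp hpF hσp hσx
    have : Fact p.Prime := ⟨hp⟩
    have : CharP F p := (CharP.charP_iff_prime_eq_zero hp).2 hpF
    set a := y ^ p - y with ha
    have hσa : σ a = a := by rw [ha, map_sub, map_pow, hy, add_pow_char, one_pow]; ring
    have ha0 : a ≠ 0 := by
      intro h
      refine pow_sub_ne_of_artinSchreier hp hpF hy (map_zero σ) ?_
      rw [← ha, h, zero_pow hp.ne_zero, sub_zero]
    obtain ⟨e, hσe, hev, hev'⟩ := exists_fixed_approximation hV hV' hind hσV hσV' hσfin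
      (inv_ne_zero ha0) (inv_ne_zero ha0) (by rw [map_inv₀, hσa])
    rw [map_inv₀, ← one_div, lt_div_iff₀ (by simpa [zero_lt_iff] using ha0), ← map_mul] at hev hev'
    obtain ⟨t, ht, hta⟩ := hF.exists_fixed_pow_sub_eq hp hσV hpF (b := e * a)
      (by rw [map_mul, hσe, hσa]) hev
    obtain ⟨t', ht', hta'⟩ := hF.exists_fixed_pow_sub_eq hp hσV' hpF (b := (1 - e) * a)
      (by rw [map_mul, map_sub, map_one, hσe, hσa]) hev'
    refine pow_sub_ne_of_artinSchreier hp hpF hy (t := t + t') (by rw [map_add, ht, ht']) ?_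
    rw [add_pow_char, ← ha]
    linear_combination hta + hta'
  · obtain ⟨σ, hσ⟩ := coe_iter τ (m * (p - 1))
    obtain ⟨σ₀, hσ₀⟩ := coe_iter τ m
    obtain ⟨ζ, hζ, hζσ⟩ := hF.exists_fixed_primitiveRoot hp hpF σ₀
    have hσζ : σ ζ = ζ := by rwa [hσ, Function.iterate_mul, ← hσ₀]
    have hσp : σ^[p] x = x := by
      rw [hσ, ← Function.iterate_mul, mul_right_comm, Function.iterate_mul]
      exact Function.iterate_fixed hmp _
    have hσx : σ x ≠ x := by
      intro h
      apply hm
      have h1 : τ^[m * p] x = τ^[m] (τ^[m * (p - 1)] x) := by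
        rw [← Function.iterate_add_apply]
        congr 2
        obtain ⟨k, rfl⟩ := Nat.exists_eq_succ_of_ne_zero hp.ne_zero
        simp; ring
      rwa [← hσ, h, hmp, eq_comm] at h1
    have hσV : ∀ x, σ x ∈ V ↔ x ∈ V := by rw [hσ]; exact iterate_mem_iff hτV _
    have hσV' : ∀ x, σ x ∈ V' ↔ x ∈ V' := by rw [hσ]; exact iterate_mem_iff hτV' _
    have hσfin : ∀ x, ∃ n ≠ 0, σ^[n] x = x := by rw [hσ]; exact hfin_iter _
    obtain ⟨y, hy0, -, hy⟩ := exists_kummer_generator hp hσp hσx hζ hσζ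
    set a := y ^ p with ha
    have ha0 : a ≠ 0 := pow_ne_zero _ hy0
    have hσa : σ a = a := by rw [ha, map_pow, hy, mul_pow, hζ.pow_eq_one, one_mul]
    have key : ∀ t, σ t = t → t ^ p ≠ a := fun t ht => pow_ne_of_kummer hp hζ hσζ hy0 hy ht
    have ha1 : 1 - a ≠ 0 := by
      intro h
      refine key 1 (map_one σ) ?_
      rw [one_pow]; linear_combination h
    set δ := (∏ k ∈ Finset.range (p - 1), (ζ ^ (k + 1) - 1)) ^ p with hδ
    have hδ0 : δ ≠ 0 := by
      refine pow_ne_zero _ (Finset.prod_ne_zero_iff.2 fun k hk => sub_ne_zero.2 ?_)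
      rw [Finset.mem_range] at hk
      exact hζ.pow_ne_one_of_pos_of_lt (Nat.succ_ne_zero k) (by omega)
    have hσδ : σ δ = δ := by simp [hδ, map_prod, hσζ]
    obtain ⟨e, hσe, hev, hev'⟩ := exists_fixed_approximation hV hV' hind hσV hσV' hσfin
      (δ := δ * (a / (1 - a))) (δ' := δ * (1 / (1 - a))) (mul_ne_zero hδ0 (div_ne_zero ha0 ha1))
      (mul_ne_zero hδ0 (div_ne_zero one_ne_zero ha1))
      (by rw [map_mul, map_div₀, map_sub, map_one, hσa, hσδ])
    have pos : ∀ (W : ValuationSubring F) {z : F}, z ≠ 0 → 0 < W.valuation z := fun W z hz => by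
      simpa [zero_lt_iff] using hz
    set b := a * (1 - e) + e with hb
    have hσb : σ b = b := by rw [hb, map_add, map_mul, map_sub, map_one, hσa, hσe]
    obtain ⟨t, -, ht, hta⟩ := hF.exists_fixed_pow_eq hp hσV hpF hζ hσζ (u := b / a)
      (by rw [map_div₀, hσb, hσa]) (by
        rw [← hδ]
        have : b / a - 1 = e * ((1 - a) / a) := by rw [hb]; field_simp; ring
        have h2 : δ = δ * (a / (1 - a)) * ((1 - a) / a) := by field_simp
        rw [this, h2, map_mul, map_mul V.valuation (δ * _)]
        exact mul_lt_mul_of_pos_right hev (pos V (div_ne_zero ha1 ha0)))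
    obtain ⟨t', ht'0, ht', hta'⟩ := hF.exists_fixed_pow_eq hp hσV' hpF hζ hσζ (u := b)
      hσb (by
        rw [← hδ]
        have : b - 1 = - ((1 - e) * (1 - a)) := by rw [hb]; ring
        have h2 : δ = δ * (1 / (1 - a)) * (1 - a) := by field_simp
        rw [this, Valuation.map_neg, h2, map_mul, map_mul V'.valuation (δ * _)]
        exact mul_lt_mul_of_pos_right hev' (pos V' ha1))
    have hb0 : b ≠ 0 := hta' ▸ pow_ne_zero p ht'0
    refine key (t' / t) (by rw [map_div₀, ht, ht']) ?_
    rw [div_pow, hta, hta', div_div_cancel₀ hb0]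

end Independent

section ResidueField

variable {S : Type*} [Field S]

lemma ValuationSubring.mem_of_pow_eq_sum (W : ValuationSubring S) {n : ℕ} {y : S} {c : ℕ → S}
    (hc : ∀ i < n, c i ∈ W) (hy : y ^ n = ∑ i ∈ Finset.range n, c i * y ^ i) : y ∈ W := by
  rw [← W.valuation_le_one_iff]
  by_contra! h
  have : W.valuation (y ^ n) < W.valuation (y ^ n) := by
    nth_rw 1 [hy]
    refine Valuation.map_sum_lt' _ ?_ fun i hi => ?_
    · rw [map_pow]; exact pow_pos (zero_lt_one.trans h) _
    · rw [Finset.mem_range] at hi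
      rw [map_mul, map_pow, map_pow]
      exact (mul_le_of_le_one_left' ((W.valuation_le_one_iff _).2 (hc i hi))).trans_lt
        (pow_lt_pow_right₀ h hi)
  exact this.false

lemma ValuationSubring.mem_of_pow_mem (W : ValuationSubring S) {n : ℕ} (hn : n ≠ 0) {y : S}
    (hy : y ^ n ∈ W) : y ∈ W := by
  rw [← W.valuation_le_one_iff] at hy ⊢
  rw [map_pow] at hy
  exact (pow_le_one_iff hn).1 hy

lemma ValuationSubring.exists_residue_eq (W : ValuationSubring S)
    (a : IsLocalRing.ResidueField W) :
    ∃ (x : S) (hx : x ∈ W), IsLocalRing.residue W ⟨x, hx⟩ = a := by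
  obtain ⟨⟨x, hx⟩, rfl⟩ := IsLocalRing.residue_surjective a
  exact ⟨x, hx, rfl⟩

lemma one_add_mul_pow_prime (p : ℕ) (hp : p.Prime) (l y : S) :
    (1 + l * y) ^ p = 1 + l ^ p * y ^ p +
      p * l * ∑ i ∈ Finset.range (p - 1), ((p.choose (i + 1) / p : ℕ) : S) * l ^ i * y ^ (i + 1) := by
  obtain ⟨q, rfl⟩ := Nat.exists_eq_succ_of_ne_zero hp.ne_zero
  rw [add_comm 1, add_pow, Finset.sum_range_succ, Finset.sum_range_succ', Finset.mul_sum]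
  have : ∀ i ∈ Finset.range q, (l * y) ^ (i + 1) * 1 ^ (q + 1 - (i + 1)) * ((q + 1).choose (i + 1) : S)
      = ((q + 1 : ℕ) : S) * l * (((q + 1).choose (i + 1) / (q + 1) : ℕ) * l ^ i * y ^ (i + 1)) := by
    intro i hi
    rw [Finset.mem_range] at hi
    have h : (q + 1).choose (i + 1) = (q + 1) * ((q + 1).choose (i + 1) / (q + 1)) :=
      (Nat.mul_div_cancel' (hp.dvd_choose_self (Nat.succ_ne_zero i) (by omega))).symm
    have h' := congrArg (Nat.cast (R := S)) h
    rw [Nat.cast_mul] at h'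
    rw [h', one_pow, mul_pow]
    ring
  rw [Finset.sum_congr rfl this]
  simp
  ring

lemma residue_weighted_sum (W : ValuationSubring S) {p : ℕ} (hp : p.Prime) {l : W}
    (hl : IsLocalRing.residue W l = 0) (y : W) :
    IsLocalRing.residue W (∑ i ∈ Finset.range (p - 1),
      ((p.choose (i + 1) / p : ℕ) : W) * l ^ i * y ^ (i + 1)) = IsLocalRing.residue W y := by
  obtain ⟨q, rfl⟩ : ∃ q, p = q + 2 := ⟨p - 2, by have := hp.two_le; omega⟩
  rw [show q + 2 - 1 = q + 1 from rfl, Finset.sum_range_succ']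
  simp [hl, Nat.div_self (Nat.succ_pos _)]

/-- The residue fields of a prime-radically closed field are prime-radically closed. -/
theorem IsPrimeRadicallyClosed.residueField (hS : IsPrimeRadicallyClosed S)
    (W : ValuationSubring S) : IsPrimeRadicallyClosed (IsLocalRing.ResidueField W) := by
  have ne_zero : ∀ p : ℕ, (p : IsLocalRing.ResidueField W) ≠ 0 → (p : S) ≠ 0 := by
    intro p hp h
    apply hp
    rw [← map_natCast (IsLocalRing.residue W), show (p : W) = 0 from Subtype.ext (by simpa using h),
      map_zero]
  refine ⟨fun p hp hpF a => ?_, fun p hp hpF => ?_, fun p hp hpF a => ?_⟩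
  · obtain ⟨x, hx, rfl⟩ := W.exists_residue_eq a
    obtain ⟨y, rfl⟩ := hS.exists_pow_eq p hp (ne_zero p hpF) x
    refine ⟨IsLocalRing.residue W ⟨y, W.mem_of_pow_mem hp.ne_zero hx⟩, ?_⟩
    rw [← map_pow]
    rfl
  · obtain ⟨ζ, hζ⟩ := hS.exists_primitiveRoot p hp (ne_zero p hpF)
    have hζW : ζ ∈ W := W.mem_of_pow_mem hp.ne_zero (by rw [hζ.pow_eq_one]; exact W.one_mem)
    refine ⟨IsLocalRing.residue W ⟨ζ, hζW⟩, ?_⟩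
    have : Fact p.Prime := ⟨hp⟩
    have h1 : (⟨ζ, hζW⟩ : W) ^ p = 1 := Subtype.ext hζ.pow_eq_one
    rw [IsPrimitiveRoot.iff_orderOf]
    refine orderOf_eq_prime (by rw [← map_pow, h1, map_one]) fun h => hpF ?_
    have h2 : ∑ i ∈ Finset.range p, (⟨ζ, hζW⟩ : W) ^ i = 0 :=
      Subtype.ext (by simpa using hζ.geom_sum_eq_zero hp.one_lt)
    have := congrArg (IsLocalRing.residue W) h2
    rw [map_sum, map_zero] at this
    simpa only [map_pow, h, one_pow, Finset.sum_const, Finset.card_range, nsmul_eq_mul,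
      mul_one] using this
  · obtain ⟨x, hx, rfl⟩ := W.exists_residue_eq a
    have : Fact p.Prime := ⟨hp⟩
    have : CharP (IsLocalRing.ResidueField W) p := (CharP.charP_iff_prime_eq_zero hp).2 hpF
    by_cases hpS : (p : S) = 0
    · obtain ⟨y, hy⟩ := hS.exists_pow_sub_eq p hp hpS x
      have hyW : y ∈ W := by
        rw [← W.valuation_le_one_iff]
        by_contra! h
        have h1 : W.valuation (y ^ p) = W.valuation y := by
          rw [show y ^ p = y + x by linear_combination hy]
          exact Valuation.map_add_eq_of_lt_left _ (((W.valuation_le_one_iff x).2 hx).trans_lt h)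
        rw [map_pow] at h1
        exact (lt_self_pow₀ h hp.one_lt).ne' h1
      refine ⟨IsLocalRing.residue W ⟨y, hyW⟩, ?_⟩
      rw [← map_pow, ← map_sub]
      exact congrArg _ (Subtype.ext hy)
    · obtain ⟨ζ, hζ⟩ := hS.exists_primitiveRoot p hp hpS
      have hζW : ζ ∈ W := W.mem_of_pow_mem hp.ne_zero (by rw [hζ.pow_eq_one]; exact W.one_mem)
      obtain ⟨l, hl⟩ : ∃ l : W, (l : S) = ζ - 1 := ⟨⟨ζ, hζW⟩ - 1, rfl⟩
      have hl0 : (l : S) ≠ 0 := by rw [hl]; exact sub_ne_zero.2 (hζ.ne_one hp.one_lt)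
      have hlres : IsLocalRing.residue W l = 0 := by
        have h1 : (l + 1) ^ p = 1 := Subtype.ext (by push_cast; rw [hl, sub_add_cancel, hζ.pow_eq_one])
        have h2 := congrArg (IsLocalRing.residue W) h1
        rw [map_pow, map_add, map_one, add_pow_char, one_pow, add_eq_right] at h2
        exact pow_eq_zero_iff hp.ne_zero |>.1 h2
      set F : W → W := fun y => ∑ i ∈ Finset.range (p - 1),
        ((p.choose (i + 1) / p : ℕ) : W) * l ^ i * y ^ (i + 1) with hF
      have hFres : ∀ y, IsLocalRing.residue W (F y) = IsLocalRing.residue W y :=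
        residue_weighted_sum W hp hlres
      obtain ⟨ε, hε⟩ : IsUnit (F 1) := by
        rw [← IsLocalRing.residue_ne_zero_iff_isUnit, hFres, map_one]
        exact one_ne_zero
      have hpl : (p : S) * l * F 1 = - (l : S) ^ p := by
        have h := one_add_mul_pow_prime p hp (l : S) 1
        rw [mul_one, hl, add_sub_cancel, hζ.pow_eq_one, ← hl] at h
        simp only [hF]
        push_cast
        simp only [one_pow, mul_one] at h ⊢
        linear_combination -h
      have hεS : ((↑ε⁻¹ : W) : S) * (F 1 : S) = 1 := by
        rw [← hε]
        exact congrArg Subtype.val ε.inv_mul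
      obtain ⟨z, hz⟩ := hS.exists_pow_eq p hp hpS (1 + (l : S) ^ p * x)
      obtain ⟨y, rfl⟩ : ∃ y, 1 + (l : S) * y = z := ⟨(z - 1) / l, by field_simp; ring⟩
      have hy : y ^ p = x + ((↑ε⁻¹ : W) : S) * ∑ i ∈ Finset.range (p - 1),
          ((p.choose (i + 1) / p : ℕ) : S) * (l : S) ^ i * y ^ (i + 1) := by
        rw [one_add_mul_pow_prime p hp] at hz
        refine mul_left_cancel₀ (pow_ne_zero p hl0) ?_
        generalize (∑ i ∈ Finset.range (p - 1),
          ((p.choose (i + 1) / p : ℕ) : S) * (l : S) ^ i * y ^ (i + 1)) = f at hz ⊢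
        linear_combination hz + (p : S) * l * f * hεS - ((↑ε⁻¹ : W) : S) * f * hpl
      have hyW : y ∈ W := by
        refine W.mem_of_pow_eq_sum (n := p) (c := fun i => if i = 0 then x else
          ((↑ε⁻¹ * ((p.choose i / p : ℕ) : W) * l ^ (i - 1) : W) : S)) (fun i _ => ?_) ?_
        · split_ifs
          · exact hx
          · exact Subtype.prop _
        · have hr : Finset.range p = Finset.range (p - 1 + 1) := by
            rw [Nat.sub_add_cancel hp.one_le]
          rw [hr, Finset.sum_range_succ', hy, Finset.mul_sum, add_comm]
          simp [mul_assoc]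
      refine ⟨IsLocalRing.residue W ⟨y, hyW⟩, ?_⟩
      have h1 : (⟨y, hyW⟩ : W) ^ p = ⟨x, hx⟩ + ↑ε⁻¹ * F ⟨y, hyW⟩ := Subtype.ext (by
        simp only [hF]
        push_cast
        exact hy)
      have h2 := congrArg (IsLocalRing.residue W) h1
      have h3 : IsLocalRing.residue W (↑ε⁻¹ : W) = 1 := by
        have := congrArg (IsLocalRing.residue W) ε.inv_mul
        rwa [map_mul, hε, hFres, map_one, mul_one] at this
      rw [map_pow, map_add, map_mul, hFres, h3, one_mul] at h2
      rw [h2, add_sub_cancel_right]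

end ResidueField

section SolvableGalois

lemma exists_normal_index_prime (G : Type*) [Group G] [Finite G] [Nontrivial G]
    (hG : Group.IsSolvable G) : ∃ N : Subgroup G, N.Normal ∧ N.index.Prime := by
  obtain ⟨N, -, hN⟩ := Set.Finite.exists_le_maximal (s := {N : Subgroup G | N.Normal ∧ N ≠ ⊤})
    (Set.toFinite _) (a := ⊥) ⟨inferInstance, bot_ne_top⟩
  have hNn : N.Normal := hN.prop.1
  have : Nontrivial (G ⧸ N) := by
    rw [← not_subsingleton_iff_nontrivial, QuotientGroup.subsingleton_iff]
    exact hN.prop.2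
  have hsimple : IsSimpleGroup (G ⧸ N) := ⟨fun H hH => by
    by_contra! h
    have hle : N ≤ H.comap (QuotientGroup.mk' N) := by
      intro x hx
      rw [Subgroup.mem_comap, QuotientGroup.mk'_apply, (QuotientGroup.eq_one_iff x).2 hx]
      exact one_mem H
    have hsurj := QuotientGroup.mk'_surjective N
    have htop : H.comap (QuotientGroup.mk' N) ≠ ⊤ := fun h' =>
      h.2 (Subgroup.comap_injective hsurj (by rw [h', Subgroup.comap_top]))
    have := le_antisymm hle (hN.2 ⟨inferInstance, htop⟩ hle)
    refine h.1 (Subgroup.comap_injective hsurj ?_)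
    rw [← this, MonoidHom.comap_bot, QuotientGroup.ker_mk']⟩
  have hsolv : Group.IsSolvable (G ⧸ N) := inferInstance
  have hcomm := IsSimpleGroup.comm_iff_isSolvable.2 hsolv
  let _ : CommGroup (G ⧸ N) := { mul_comm := hcomm }
  exact ⟨N, hNn, IsSimpleGroup.prime_card⟩

variable {k F : Type*} [Field k] [Field F] [Algebra k F]

lemma exists_isGalois_finrank_prime [FiniteDimensional k F] [IsGalois k F]
    (hs : Group.IsSolvable (F ≃ₐ[k] F)) [Nontrivial (F ≃ₐ[k] F)] :
    ∃ E : IntermediateField k F, IsGalois k E ∧ (Module.finrank k E).Prime := by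
  obtain ⟨N, hN, hp⟩ := exists_normal_index_prime _ hs
  refine ⟨IntermediateField.fixedField N, inferInstance, ?_⟩
  have h1 := Module.finrank_mul_finrank k (IntermediateField.fixedField N) F
  rw [IntermediateField.finrank_fixedField_eq_card, ← IsGalois.card_aut_eq_finrank k F,
    ← N.index_mul_card] at h1
  have h0 : Nat.card N ≠ 0 := Nat.card_pos.ne'
  rwa [mul_right_cancel₀ h0 h1]

/-- A prime-radically closed field has no cyclic extension of prime degree. -/
lemma IsPrimeRadicallyClosed.not_prime_finrank (hk : IsPrimeRadicallyClosed k) [IsGalois k F] :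
    ¬ (Module.finrank k F).Prime := by
  intro hp
  have : FiniteDimensional k F := Module.finite_of_finrank_pos hp.pos
  set p := Module.finrank k F with hpdef
  have hcard : Nat.card (F ≃ₐ[k] F) = p := IsGalois.card_aut_eq_finrank k F
  have : Fact p.Prime := ⟨hp⟩
  have : Nontrivial (F ≃ₐ[k] F) := by
    rw [← Finite.one_lt_card_iff_nontrivial, hcard]; exact hp.one_lt
  obtain ⟨σ, hσ⟩ := exists_ne (1 : F ≃ₐ[k] F)
  have hgen := zpowers_eq_top_of_prime_card hcard hσ
  have hfix : ∀ y, σ y = y → ∃ c, algebraMap k F c = y := by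
    intro y hy
    refine (IsGalois.mem_range_algebraMap_iff_fixed y).2 fun τ => ?_
    have hle : Subgroup.zpowers σ ≤ MulAction.stabilizer (F ≃ₐ[k] F) y := by
      rw [Subgroup.zpowers_le]; exact hy
    rw [hgen] at hle
    exact hle (Subgroup.mem_top τ)
  have hiter : ∀ (n : ℕ) (x : F), (σ : F ≃+* F)^[n] x = (σ ^ n) x := by
    intro n x
    induction n with
    | zero => rfl
    | succ n ih => rw [Function.iterate_succ_apply', ih, pow_succ']; rfl
  have hσp : ∀ x, (σ : F ≃+* F)^[p] x = x := fun x => by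
    rw [hiter, ← hcard, pow_card_eq_one']; rfl
  obtain ⟨x, hx⟩ : ∃ x, (σ : F ≃+* F) x ≠ x := by
    by_contra! h
    exact hσ (AlgEquiv.ext h)
  by_cases hpk : (p : k) = 0
  · have hpF : (p : F) = 0 := by rw [← map_natCast (algebraMap k F), hpk, map_zero]
    have : CharP F p := (CharP.charP_iff_prime_eq_zero hp).2 hpF
    obtain ⟨y, -, hy⟩ := exists_artinSchreier_generator hp hpF (hσp x) hx
    obtain ⟨c, hc⟩ := hfix (y ^ p - y) (by
      have hy' : σ y = y + 1 := hy
      rw [map_sub, map_pow, hy', add_pow_char, one_pow]; ring)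
    obtain ⟨t, ht⟩ := hk.exists_pow_sub_eq p hp hpk c
    refine pow_sub_ne_of_artinSchreier hp hpF hy (t := algebraMap k F t) (σ.commutes t) ?_
    rw [← hc, ← ht, map_sub, map_pow]
  · obtain ⟨ζ, hζ⟩ := hk.exists_primitiveRoot p hp hpk
    have hζF := hζ.map_of_injective (algebraMap k F).injective
    obtain ⟨y, hy0, -, hy⟩ := exists_kummer_generator hp (hσp x) hx hζF (σ.commutes ζ)
    obtain ⟨c, hc⟩ := hfix (y ^ p) (by
      have hy' : σ y = algebraMap k F ζ * y := hy
      rw [map_pow, hy', mul_pow, hζF.pow_eq_one, one_mul])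
    obtain ⟨t, ht⟩ := hk.exists_pow_eq p hp hpk c
    refine pow_ne_of_kummer hp hζF (σ.commutes ζ) hy0 hy (t := algebraMap k F t) (σ.commutes t) ?_
    rw [← hc, ← ht, map_pow]

theorem IsPrimeRadicallyClosed.subsingleton_algEquiv (hk : IsPrimeRadicallyClosed k)
    [FiniteDimensional k F] [IsGalois k F] (hs : Group.IsSolvable (F ≃ₐ[k] F)) :
    Subsingleton (F ≃ₐ[k] F) := by
  rw [← not_nontrivial_iff_subsingleton]
  intro
  obtain ⟨E, hE, hp⟩ := exists_isGalois_finrank_prime (k := k) (F := F) hs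
  exact hk.not_prime_finrank hp

theorem IsPrimeRadicallyClosed.isSolvClosed (hk : IsPrimeRadicallyClosed k) : IsSolvClosed k := by
  intro L hfin hgal hs
  have := hk.subsingleton_algEquiv hs
  rw [← IntermediateField.finrank_eq_one_iff, ← IsGalois.card_aut_eq_finrank]
  exact Nat.card_of_subsingleton 1

/-- A finite solvable group of automorphisms of a field is trivial if its fixed field is
prime-radically closed. -/
theorem IsPrimeRadicallyClosed.subsingleton_of_fixedPoints {A : Type*} [Group A] [Finite A]
    [MulSemiringAction A F] [FaithfulSMul A F] (hs : Group.IsSolvable A)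
    (hk : IsPrimeRadicallyClosed (FixedPoints.subfield A F)) : Subsingleton A := by
  let e := FixedPoints.toAlgAutMulEquiv A F
  have hs' : Group.IsSolvable (F ≃ₐ[FixedPoints.subfield A F] F) :=
    Group.isSolvable_of_surjective (f := e.toMonoidHom) e.surjective
  have := Fintype.ofFinite A
  have := hk.subsingleton_algEquiv hs'
  exact e.toEquiv.subsingleton

end SolvableGalois

section PurelyInseparable

open Polynomial

variable {k F : Type*} [Field k] [Field F] [Algebra k F]

lemma isPurelyInseparable_of_lifts
    (h : ∀ x : F, ∃ n ≠ 0, (X - C x) ^ n ∈ lifts (algebraMap k F)) : IsPurelyInseparable k F := by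
  rw [isPurelyInseparable_iff]
  intro x
  obtain ⟨n, hn, hx⟩ := h x
  obtain ⟨f, hf, -, hmonic⟩ := lifts_and_natDegree_eq_and_monic hx ((monic_X_sub_C x).pow n)
  have hf0 : aeval x f = 0 := by
    rw [aeval_def, ← eval_map, hf, eval_pow, eval_sub, eval_X, eval_C, sub_self, zero_pow hn]
  have hint : IsIntegral k x := ⟨f, hmonic, by rwa [← aeval_def]⟩
  refine ⟨hint, fun hsep => ?_⟩
  have hdvd : (minpoly k x).map (algebraMap k F) ∣ X - C x := by
    have hsq : Squarefree ((minpoly k x).map (algebraMap k F)) := (Separable.map hsep).squarefree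
    rw [← hsq.dvd_pow_iff_dvd hn, ← hf]
    exact Polynomial.map_dvd _ (minpoly.dvd k x hf0)
  have hdeg := natDegree_le_of_dvd hdvd (X_sub_C_ne_zero x)
  rw [natDegree_map, natDegree_X_sub_C] at hdeg
  by_contra h
  have := (minpoly.two_le_natDegree_iff hint).2 h
  omega

variable (k F) in
lemma IsPrimeRadicallyClosed.of_isPurelyInseparable [IsPurelyInseparable k F]
    (hF : IsPrimeRadicallyClosed F) : IsPrimeRadicallyClosed k := by
  have hmem : ∀ (f : k[X]) (y : F), f.Separable → aeval y f = 0 → ∃ c : k, algebraMap k F c = y :=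
    fun f y hf hy => IsPurelyInseparable.inseparable' y (hf.of_dvd (minpoly.dvd k y hy))
  have hne : ∀ p : ℕ, (p : k) ≠ 0 → (p : F) ≠ 0 := fun p hp => by
    rwa [← map_natCast (algebraMap k F), Ne, map_eq_zero]
  refine ⟨fun p hp hpk a => ?_, fun p hp hpk => ?_, fun p hp hpk a => ?_⟩
  · rcases eq_or_ne a 0 with rfl | ha
    · exact ⟨0, zero_pow hp.ne_zero⟩
    obtain ⟨y, hy⟩ := hF.exists_pow_eq p hp (hne p hpk) (algebraMap k F a)
    obtain ⟨c, rfl⟩ := hmem (X ^ p - C a) y (separable_X_pow_sub_C a hpk ha) (by simp [hy])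
    exact ⟨c, (algebraMap k F).injective (by rw [map_pow, hy])⟩
  · obtain ⟨ζ, hζ⟩ := hF.exists_primitiveRoot p hp (hne p hpk)
    obtain ⟨c, rfl⟩ := hmem (X ^ p - C 1) ζ (separable_X_pow_sub_C 1 hpk one_ne_zero)
      (by simp [hζ.pow_eq_one])
    exact ⟨c, hζ.of_map_of_injective (algebraMap k F).injective⟩
  · have : Fact p.Prime := ⟨hp⟩
    have : CharP k p := (CharP.charP_iff_prime_eq_zero hp).2 hpk
    obtain ⟨y, hy⟩ := hF.exists_pow_sub_eq p hp
      (by rw [← map_natCast (algebraMap k F), hpk, map_zero]) (algebraMap k F a)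
    obtain ⟨c, rfl⟩ := hmem (X ^ p - X - C a) y (by
      rw [separable_def]
      refine ⟨0, -1, ?_⟩
      simp [derivative_X_pow]) (by simp [hy])
    exact ⟨c, (algebraMap k F).injective (by rw [map_sub, map_pow, hy])⟩

variable (k F) in
lemma IsPrimeRadicallyClosed.of_isPurelyInseparable_bot [IsPurelyInseparable k F]
    (hk : IsPrimeRadicallyClosed k) : IsPrimeRadicallyClosed F := by
  have hne : ∀ p : ℕ, (p : F) ≠ 0 → (p : k) ≠ 0 := fun p hp h => hp (by
    rw [← map_natCast (algebraMap k F), h, map_zero])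
  obtain ⟨q, hq⟩ := ExpChar.exists k
  have hqF : ExpChar F q := expChar_of_injective_algebraMap (algebraMap k F).injective q
  refine ⟨fun p hp hpF a => ?_, fun p hp hpF => ?_, fun p hp hpF a => ?_⟩
  · rcases eq_or_ne a 0 with rfl | ha
    · exact ⟨0, zero_pow hp.ne_zero⟩
    obtain ⟨n, c, hc⟩ := IsPurelyInseparable.pow_mem k q a
    obtain ⟨z, rfl⟩ := hk.exists_pow_eq p hp (hne p hpF) c
    have hz : algebraMap k F z ≠ 0 := by
      intro h
      rw [map_pow, h, zero_pow hp.ne_zero] at hc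
      exact pow_ne_zero _ ha hc.symm
    have hcop : IsCoprime ((q ^ n : ℕ) : ℤ) (p : ℤ) := by
      rw [Nat.isCoprime_iff_coprime]
      refine Nat.Coprime.pow_left n ?_
      rcases hq with _ | hq'
      · exact Nat.coprime_one_left p
      · refine (Nat.coprime_primes ‹_› hp).2 ?_
        rintro rfl
        exact hne q hpF (CharP.cast_eq_zero k q)
    obtain ⟨u, v, huv⟩ := hcop
    refine ⟨algebraMap k F z ^ u * a ^ v, ?_⟩
    rw [mul_pow, ← zpow_natCast, ← zpow_mul, mul_comm u, zpow_mul, zpow_natCast, ← map_pow, hc,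
      ← zpow_natCast, ← zpow_natCast, ← zpow_mul, ← zpow_mul, ← zpow_add₀ ha]
    convert zpow_one a
    linarith
  · obtain ⟨ζ, hζ⟩ := hk.exists_primitiveRoot p hp (hne p hpF)
    exact ⟨_, hζ.map_of_injective (algebraMap k F).injective⟩
  · have : Fact p.Prime := ⟨hp⟩
    have : CharP F p := (CharP.charP_iff_prime_eq_zero hp).2 hpF
    have hpk : (p : k) = 0 := by
      rwa [← map_eq_zero (algebraMap k F), map_natCast]
    have : CharP k p := (CharP.charP_iff_prime_eq_zero hp).2 hpk
    obtain ⟨n, c, hc⟩ := IsPurelyInseparable.pow_mem k p a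
    obtain ⟨z, rfl⟩ := hk.exists_pow_sub_eq p hp hpk c
    refine ⟨algebraMap k F z - ∑ i ∈ Finset.range n, a ^ p ^ i, ?_⟩
    have := Finset.sum_range_sub (fun i => a ^ p ^ i) n
    rw [Finset.sum_sub_distrib, ← hc, map_sub, map_pow] at this
    simp only [pow_zero, pow_one, pow_succ p, pow_mul] at this
    rw [sub_pow_char, sum_pow_char]
    linear_combination -this

end PurelyInseparable

theorem isSolvable_of_ker_le {G A B : Type*} [Group G] [Group A] [Group B]
    (f : G →* A) (g : G →* B) (hg : Function.Surjective g) (h : f.ker ≤ g.ker)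
    (hA : Group.IsSolvable A) : Group.IsSolvable B := by
  have : Group.IsSolvable (G ⧸ f.ker) :=
    Group.isSolvable_of_isSolvable_injective (QuotientGroup.kerLift_injective f)
  refine Group.isSolvable_of_surjective (f := QuotientGroup.lift f.ker g h) fun b => ?_
  obtain ⟨x, rfl⟩ := hg b
  exact ⟨x, rfl⟩

open IntermediateField in
theorem isSolvable_sup {K Ω : Type*} [Field K] [Field Ω] [Algebra K Ω] [Normal K Ω]
    (M N : IntermediateField K Ω) [Normal K M] [Normal K N]
    (hM : Group.IsSolvable (M ≃ₐ[K] M)) (hN : Group.IsSolvable (N ≃ₐ[K] N)) :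
    Group.IsSolvable ((M ⊔ N : IntermediateField K Ω) ≃ₐ[K] (M ⊔ N : IntermediateField K Ω)) := by
  refine isSolvable_of_ker_le
    ((AlgEquiv.restrictNormalHom (K₁ := Ω) M).prod (AlgEquiv.restrictNormalHom N))
    (AlgEquiv.restrictNormalHom (K₁ := Ω) _) (AlgEquiv.restrictNormalHom_surjective Ω) ?_ inferInstance
  rw [MonoidHom.ker_prod, restrictNormalHom_ker, restrictNormalHom_ker, restrictNormalHom_ker,
    ← fixingSubgroup_sup]

/-- `N` is a finite Galois subextension with solvable Galois group. -/
structure IsFiniteSolvableGalois (K : Type*) {Ω : Type*} [Field K] [Field Ω] [Algebra K Ω]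
    (N : IntermediateField K Ω) : Prop where
  finiteDimensional : FiniteDimensional K N
  isGalois : IsGalois K N
  isSolvable : Group.IsSolvable (N ≃ₐ[K] N)

open IntermediateField in
theorem IsFiniteSolvableGalois.sup {K Ω : Type*} [Field K] [Field Ω] [Algebra K Ω] [Normal K Ω]
    {M N : IntermediateField K Ω} (hM : IsFiniteSolvableGalois K M)
    (hN : IsFiniteSolvableGalois K N) : IsFiniteSolvableGalois K (M ⊔ N) := by
  have := hM.1
  have := hM.2
  have := hN.1
  have := hN.2
  exact ⟨inferInstance, ⟨⟩, isSolvable_sup M N hM.3 hN.3⟩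

theorem maxSolvableExt_eq_iSup (K Ω : Type*) [Field K] [Field Ω] [Algebra K Ω] :
    maxSolvableExt K Ω = ⨆ N : {N : IntermediateField K Ω // IsFiniteSolvableGalois K N}, N.1 :=
  le_antisymm (iSup_le fun N => le_iSup_of_le ⟨N.1, N.2.1, N.2.2.1, N.2.2.2⟩ le_rfl)
    (iSup_le fun N => le_iSup_of_le (f := fun L : {L : IntermediateField K Ω //
      FiniteDimensional K L ∧ IsGalois K L ∧ Group.IsSolvable (L ≃ₐ[K] L)} => L.1)
      ⟨N.1, N.2.1, N.2.2, N.2.3⟩ le_rfl)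

theorem IsFiniteSolvableGalois.le_maxSolvableExt {K Ω : Type*} [Field K] [Field Ω] [Algebra K Ω]
    {N : IntermediateField K Ω} (hN : IsFiniteSolvableGalois K N) : N ≤ maxSolvableExt K Ω := by
  rw [maxSolvableExt_eq_iSup]
  exact le_iSup_of_le ⟨N, hN⟩ le_rfl

theorem isFiniteSolvableGalois_bot (K Ω : Type*) [Field K] [Field Ω] [Algebra K Ω] :
    IsFiniteSolvableGalois K (⊥ : IntermediateField K Ω) :=
  ⟨inferInstance, isGalois_bot,
    Group.isSolvable_of_isSolvable_injective
      (f := ((IntermediateField.botEquiv K Ω).autCongr.toMonoidHom))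
      (IntermediateField.botEquiv K Ω).autCongr.injective⟩

theorem exists_isFiniteSolvableGalois {K Ω : Type*} [Field K] [Field Ω] [Algebra K Ω] [Normal K Ω]
    {x : Ω} (hx : x ∈ maxSolvableExt K Ω) :
    ∃ N : IntermediateField K Ω, IsFiniteSolvableGalois K N ∧ x ∈ N := by
  have : Nonempty {N : IntermediateField K Ω // IsFiniteSolvableGalois K N} :=
    ⟨⟨⊥, isFiniteSolvableGalois_bot K Ω⟩⟩
  rw [maxSolvableExt_eq_iSup, ← SetLike.mem_coe, IntermediateField.coe_iSup_of_directed,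
    Set.mem_iUnion] at hx
  · obtain ⟨⟨N, hN⟩, hx⟩ := hx
    exact ⟨N, hN, hx⟩
  · exact fun M N => ⟨⟨M.1 ⊔ N.1, M.2.sup N.2⟩, le_sup_left, le_sup_right⟩

instance isGalois_maxSolvableExt {K Ω : Type*} [Field K] [Field Ω] [Algebra K Ω] :
    IsGalois K (maxSolvableExt K Ω) := by
  have (N : {N : IntermediateField K Ω // IsFiniteSolvableGalois K N}) : IsGalois K N.1 := N.2.2
  rw [maxSolvableExt_eq_iSup]
  have h1 := IntermediateField.isSeparable_iSup (F := K) (E := Ω)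
    (t := fun N : {N : IntermediateField K Ω // IsFiniteSolvableGalois K N} => N.1)
  have h2 := IntermediateField.normal_iSup K Ω
    fun N : {N : IntermediateField K Ω // IsFiniteSolvableGalois K N} => N.1
  exact { to_isSeparable := h1, to_normal := h2 }

section

open Polynomial

theorem mem_maxSolvableExt_iff {K Ω : Type*} [Field K] [Field Ω] [Algebra K Ω] [Normal K Ω]
    {x : Ω} : x ∈ maxSolvableExt K Ω ↔ IsSeparable K x ∧ Group.IsSolvable (minpoly K x).Gal := by
  constructor
  · intro hx
    obtain ⟨N, hN, hxN⟩ := exists_isFiniteSolvableGalois hx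
    have := hN.1
    have := hN.2
    have := hN.3
    lift x to N using hxN
    refine ⟨?_, ?_⟩
    · rw [IsSeparable]
      have := Algebra.IsSeparable.isSeparable K x
      rwa [IsSeparable, ← minpoly.algebraMap_eq (algebraMap N Ω).injective x] at this
    · have : (minpoly K (x : Ω)) = minpoly K x := minpoly.algebraMap_eq (algebraMap N Ω).injective x
      rw [this]
      have : Fact (((minpoly K x).map (algebraMap K N)).Splits) := ⟨Normal.splits inferInstance x⟩
      exact Group.isSolvable_of_surjective (Gal.restrict_surjective (minpoly K x) N)
  · rintro ⟨h1, h2⟩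
    have hsp : ((minpoly K x).map (algebraMap K Ω)).Splits := Normal.splits inferInstance x
    have hN := IntermediateField.adjoin_rootSet_isSplittingField hsp
    set N := IntermediateField.adjoin K ((minpoly K x).rootSet Ω)
    have hxN : x ∈ N := IntermediateField.subset_adjoin _ _ (by
      rw [mem_rootSet]
      exact ⟨minpoly.ne_zero h1.isIntegral, minpoly.aeval K x⟩)
    refine IsFiniteSolvableGalois.le_maxSolvableExt ⟨?_, ?_, ?_⟩ hxN
    · exact IsSplittingField.finiteDimensional N (minpoly K x)
    · exact IsGalois.of_separable_splitting_field (p := minpoly K x) h1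
    · exact Group.isSolvable_of_isSolvable_injective (G := N ≃ₐ[K] N) (G' := (minpoly K x).Gal)
        (f := (IsSplittingField.algEquiv N (minpoly K x)).autCongr.toMonoidHom)
        (IsSplittingField.algEquiv N (minpoly K x)).autCongr.injective

end

section

open Polynomial

theorem gal_X_pow_sub_X_sub_C_isSolvable {F : Type*} [Field F] {p : ℕ} (hp : p.Prime)
    (hpF : (p : F) = 0) (a : F) : Group.IsSolvable (X ^ p - X - C a : F[X]).Gal := by
  have hpE : (p : (X ^ p - X - C a : F[X]).SplittingField) = 0 := by
    rw [← map_natCast (algebraMap F _), hpF, map_zero]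
  have := Fact.mk hp
  have := (CharP.charP_iff_prime_eq_zero hp).2 hpE
  have hne : (X ^ p - X - C a : F[X]) ≠ 0 := by
    intro h
    have := congrArg (coeff · p) h
    simp [coeff_X, coeff_C, hp.one_lt.ne, hp.ne_zero] at this
  set E := (X ^ p - X - C a : F[X]).SplittingField
  have key (x : E) (hx : x ∈ (X ^ p - X - C a : F[X]).rootSet E) (σ : E ≃ₐ[F] E) :
      ∃ j : ℤ, σ x = x + j := by
    have hx : x ^ p - x - algebraMap F _ a = 0 := by
      simpa [mem_rootSet_of_ne hne] using hx
    obtain ⟨j, hj⟩ := exists_intCast_of_pow_eq_self hp hpE (d := σ x - x) (by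
      have h1 := congrArg σ hx
      rw [map_sub, map_sub, map_pow, AlgEquiv.commutes, map_zero] at h1
      rw [sub_pow_char]
      linear_combination h1 - hx)
    exact ⟨j, by rw [hj]; ring⟩
  refine Group.isSolvable_of_comm (G := E ≃ₐ[F] E) fun σ τ => Gal.ext (p := X ^ p - X - C a) ?_
  intro x hx
  obtain ⟨c, hc⟩ := key x hx σ
  obtain ⟨d, hd⟩ := key x hx τ
  change σ (τ x) = τ (σ x)
  rw [hc, hd, map_add, map_add, map_intCast, map_intCast, hc, hd]
  ring

theorem gal_comp_isSolvable {F : Type*} [Field F] (p r : F[X]) (hr : r.natDegree ≠ 0)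
    (hps : Group.IsSolvable p.Gal)
    (hrs : ∀ a : p.SplittingField,
      Group.IsSolvable (r.map (algebraMap F p.SplittingField) - C a).Gal) :
    Group.IsSolvable (p.comp r).Gal := by
  refine gal_isSolvable_tower p (p.comp r) (Gal.splits_in_splittingField_of_comp _ _ hr) hps ?_
  obtain ⟨s, hs⟩ := splits_iff_exists_multiset.1 (SplittingField.splits p)
  rw [map_comp, hs, mul_comp, C_comp]
  apply gal_mul_isSolvable (gal_C_isSolvable _)
  rw [multiset_prod_comp]
  apply gal_prod_isSolvable
  intro q hq
  rw [Multiset.mem_map] at hq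
  obtain ⟨q, hq, rfl⟩ := hq
  rw [Multiset.mem_map] at hq
  obtain ⟨q, _, rfl⟩ := hq
  rw [sub_comp, X_comp, C_comp]
  exact hrs q

theorem mem_maxSolvableExt_of_aeval_mem {K Ω : Type*} [Field K] [Field Ω] [Algebra K Ω]
    [Normal K Ω] {x : Ω} (r : K[X]) (hr : r.natDegree ≠ 0)
    (hrs : ∀ (p : K[X]) (a : p.SplittingField),
      Group.IsSolvable (r.map (algebraMap K p.SplittingField) - C a).Gal)
    (hx : aeval x r ∈ maxSolvableExt K Ω)
    (hsep : ((r.map (algebraMap K (maxSolvableExt K Ω))) - C (⟨_, hx⟩ : maxSolvableExt K Ω)).Separable) :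
    x ∈ maxSolvableExt K Ω := by
  obtain ⟨h1, h2⟩ := mem_maxSolvableExt_iff.1 hx
  refine mem_maxSolvableExt_iff.2 ⟨?_, ?_⟩
  · refine IsSeparable.of_algebra_isSeparable_of_isSeparable K (E := maxSolvableExt K Ω) ?_
    refine hsep.of_dvd (minpoly.dvd _ _ ?_)
    simp [IntermediateField.algebraMap_apply]
  · have hp : (minpoly K (aeval x r)).comp r ≠ 0 := by
      intro h
      rcases comp_eq_zero_iff.mp h with h' | h'
      · exact minpoly.ne_zero h1.isIntegral h'
      · exact hr (by rw [h'.2, natDegree_C])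
    refine gal_isSolvable_of_splits ⟨(SplittingField.splits _).of_dvd (map_ne_zero hp)
      ((map_dvd_map' _).mpr (minpoly.dvd K x ?_))⟩
      (gal_comp_isSolvable _ r hr h2 (hrs _))
    rw [aeval_comp, minpoly.aeval]

theorem IsPrimeRadicallyClosed.maxSolvableExt (K Ω : Type*) [Field K] [Field Ω] [Algebra K Ω]
    [Algebra.IsAlgebraic K Ω] [IsAlgClosed Ω] : IsPrimeRadicallyClosed (maxSolvableExt K Ω) := by
  have : IsAlgClosure K Ω := ⟨‹_›, ‹_›⟩
  have hnorm : Normal K Ω := IsAlgClosure.normal K Ω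
  have cast_ne {p : ℕ} (h : (p : _root_.maxSolvableExt K Ω) ≠ 0) : (p : Ω) ≠ 0 := by
    rw [← map_natCast (algebraMap (_root_.maxSolvableExt K Ω) Ω)]
    exact (_root_.map_ne_zero _).2 h
  have hpow (p : ℕ) (hp : p.Prime) (hpF : (p : _root_.maxSolvableExt K Ω) ≠ 0)
      (a : _root_.maxSolvableExt K Ω) (y : Ω) (hy : y ^ p = a) : y ∈ _root_.maxSolvableExt K Ω := by
    by_cases hy0 : y = 0
    · rw [hy0]; exact zero_mem _
    refine mem_maxSolvableExt_of_aeval_mem (X ^ p) (by simpa using hp.ne_zero) ?_ (by simp [hy]) ?_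
    · intro q a
      rw [Polynomial.map_pow, map_X]
      exact gal_X_pow_sub_C_isSolvable p a
    · rw [Polynomial.map_pow, map_X]
      exact separable_X_pow_sub_C _ hpF (by simpa [Subtype.ext_iff] using fun h => absurd h hy0)
  refine ⟨fun p hp hpF a => ?_, fun p hp hpF => ?_, fun p hp hpF a => ?_⟩
  · obtain ⟨y, hy⟩ := IsAlgClosed.exists_pow_nat_eq (a : Ω) hp.pos
    exact ⟨⟨y, hpow p hp hpF a y hy⟩, Subtype.ext hy⟩
  · have : NeZero (p : Ω) := ⟨cast_ne hpF⟩
    obtain ⟨ζ, hζ⟩ := HasEnoughRootsOfUnity.exists_primitiveRoot Ω p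
    refine ⟨⟨ζ, hpow p hp hpF 1 ζ (by simpa using hζ.pow_eq_one)⟩, ?_⟩
    exact IsPrimitiveRoot.of_map_of_injective (f := algebraMap (_root_.maxSolvableExt K Ω) Ω) hζ
      (algebraMap (_root_.maxSolvableExt K Ω) Ω).injective
  · have hpK : (p : K) = 0 := by
      apply (algebraMap K (_root_.maxSolvableExt K Ω)).injective
      rw [map_natCast, hpF, map_zero]
    have hdeg : (X ^ p - X : K[X]).natDegree = p := by
      rw [natDegree_sub_eq_left_of_natDegree_lt] <;> simp [hp.one_lt]
    obtain ⟨y, hy⟩ := IsAlgClosed.exists_root (X ^ p - X - C (a : Ω)) (by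
      rw [degree_sub_C] <;> rw [degree_sub_eq_left_of_degree_lt] <;>
      simp [hp.one_lt, hp.pos, hp.ne_zero])
    have hy : y ^ p - y = a := by simpa [sub_eq_zero] using hy
    refine ⟨⟨y, ?_⟩, Subtype.ext hy⟩
    refine mem_maxSolvableExt_of_aeval_mem (X ^ p - X) (by rw [hdeg]; exact hp.ne_zero) ?_
      (by simp [hy]) ?_
    · intro q a
      rw [Polynomial.map_sub, Polynomial.map_pow, map_X]
      refine gal_X_pow_sub_X_sub_C_isSolvable hp ?_ a
      rw [← map_natCast (algebraMap K q.SplittingField), hpK, map_zero]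
    · rw [separable_def]
      refine ⟨0, -1, ?_⟩
      simp [derivative_X_pow, hpF]
      ring

theorem IsPrimeRadicallyClosed.of_bijective {F F' : Type*} [Field F] [Field F'] (e : F →+* F')
    (he : Function.Bijective e) (h : IsPrimeRadicallyClosed F') : IsPrimeRadicallyClosed F := by
  have hcast (p : ℕ) : (p : F') = 0 ↔ (p : F) = 0 := by
    rw [← map_natCast e, _root_.map_eq_zero]
  refine ⟨fun p hp hpF a => ?_, fun p hp hpF => ?_, fun p hp hpF a => ?_⟩
  · obtain ⟨y, hy⟩ := h.exists_pow_eq p hp (mt (hcast p).1 hpF) (e a)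
    obtain ⟨y, rfl⟩ := he.2 y
    exact ⟨y, he.1 (by simpa using hy)⟩
  · obtain ⟨y, hy⟩ := h.exists_primitiveRoot p hp (mt (hcast p).1 hpF)
    obtain ⟨y, rfl⟩ := he.2 y
    exact ⟨y, hy.of_map_of_injective he.1⟩
  · obtain ⟨y, hy⟩ := h.exists_pow_sub_eq p hp ((hcast p).2 hpF) (e a)
    obtain ⟨y, rfl⟩ := he.2 y
    exact ⟨y, he.1 (by simpa using hy)⟩

theorem IsSolvClosed.isPrimeRadicallyClosed {k : Type*} [Field k] (hk : IsSolvClosed k) :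
    IsPrimeRadicallyClosed k := by
  have h : solvClosure k = ⊥ := by
    rw [eq_bot_iff]
    exact iSup_le fun N => (hk N.1 N.2.1 N.2.2.1 N.2.2.2).le
  refine .of_bijective (algebraMap k (solvClosure k)) ⟨(algebraMap k _).injective, ?_⟩
    (.maxSolvableExt k (AlgebraicClosure k))
  rintro ⟨x, hx⟩
  rw [h, IntermediateField.mem_bot] at hx
  obtain ⟨y, hy⟩ := hx
  exact ⟨y, Subtype.ext hy⟩

end

section

open Polynomial

theorem ValuationSubring.residue_eq_residue_iff {F : Type*} [Field F] (V : ValuationSubring F)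
    {x y : F} (hx : x ∈ V) (hy : y ∈ V) :
    IsLocalRing.residue V ⟨x, hx⟩ = IsLocalRing.residue V ⟨y, hy⟩ ↔ V.valuation (x - y) < 1 := by
  rw [← sub_eq_zero, ← map_sub, IsLocalRing.residue_eq_zero_iff,
    ValuationSubring.valuation_lt_one_iff]
  rfl

/-- The inclusion of `V ∩ E` into `V`. -/
def ValuationSubring.comapInclusion (E : Type*) {F : Type*} [Field E] [Field F] [Algebra E F]
    (V : ValuationSubring F) : V.comap (algebraMap E F) →+* V :=
  ((algebraMap E F).comp (V.comap (algebraMap E F)).subtype).codRestrict V.toSubring fun x => x.2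

instance (E : Type*) {F : Type*} [Field E] [Field F] [Algebra E F] (V : ValuationSubring F) :
    IsLocalHom (V.comapInclusion E) where
  map_nonunit a ha := by
    have h1 := V.valuation_eq_one_iff _ |>.1 ha
    have h2 : algebraMap E F a ≠ 0 := by
      intro h
      change V.valuation (algebraMap E F a) = 1 at h1
      rw [h, map_zero] at h1
      exact zero_ne_one h1
    have h3 : (a : E)⁻¹ ∈ V.comap (algebraMap E F) := by
      rw [ValuationSubring.mem_comap, map_inv₀, ← V.valuation_le_one_iff, map_inv₀]
      change V.valuation (algebraMap E F a) = 1 at h1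
      rw [h1, inv_one]
    refine IsUnit.of_mul_eq_one ⟨_, h3⟩ (Subtype.ext (mul_inv_cancel₀ fun h => h2 ?_))
    rw [h, map_zero]

/-- The inclusion of the residue field of `V ∩ E` into the residue field of `V`. -/
def ValuationSubring.residueInclusion (E : Type*) {F : Type*} [Field E] [Field F] [Algebra E F]
    (V : ValuationSubring F) :
    IsLocalRing.ResidueField (V.comap (algebraMap E F)) →+* IsLocalRing.ResidueField V :=
  IsLocalRing.ResidueField.map (V.comapInclusion E)

theorem ValuationSubring.residueInclusion_residue (E : Type*) {F : Type*} [Field E] [Field F]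
    [Algebra E F] (V : ValuationSubring F) {a : E} (ha : algebraMap E F a ∈ V) :
    V.residueInclusion E (IsLocalRing.residue _ ⟨a, ha⟩) = IsLocalRing.residue V ⟨_, ha⟩ :=
  rfl

theorem ValuationSubring.X_sub_C_pow_mem_lifts {E F : Type*} [Field E] [Field F] [Algebra E F]
    [Normal E F] (V : ValuationSubring F) {x : F} (hx : x ∈ V)
    (hV : ∀ (τ : F ≃ₐ[E] F) (x), τ x ∈ V ↔ x ∈ V)
    (hτ : ∀ τ : F ≃ₐ[E] F, V.valuation (τ x - x) < 1) :
    ∃ n ≠ 0, (X - C (IsLocalRing.residue V ⟨x, hx⟩)) ^ n ∈ lifts (V.residueInclusion E) := by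
  have hint : IsIntegral E x := Normal.isIntegral inferInstance x
  have hsp : ((minpoly E x).map (algebraMap E F)).Splits := Normal.splits inferInstance x
  have hroots : ∀ r ∈ ((minpoly E x).map (algebraMap E F)).roots,
      ∃ hr : r ∈ V, IsLocalRing.residue V ⟨r, hr⟩ = IsLocalRing.residue V ⟨x, hx⟩ := by
    intro r hr
    rw [mem_roots_map (minpoly.ne_zero hint)] at hr
    obtain ⟨τ, rfl⟩ := minpoly.exists_algEquiv_of_root' (K := E) (x := r) (y := x)
      hint.isAlgebraic hr
    exact ⟨(hV τ x).2 hx, (V.residue_eq_residue_iff _ _).2 (hτ τ)⟩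
  obtain ⟨m, hm⟩ : ∃ m : Multiset V, m.map (↑) = ((minpoly E x).map (algebraMap E F)).roots :=
    CanLift.prf _ fun r hr => (hroots r hr).1
  let g : V[X] := (m.map fun r => X - C r).prod
  have hg : g.map V.subtype = (minpoly E x).map (algebraMap E F) := by
    rw [hsp.eq_prod_roots_of_monic ((minpoly.monic hint).map _), ← hm, Polynomial.map_multiset_prod,
      Multiset.map_map, Multiset.map_map]
    simp
  have hg' : g.map (IsLocalRing.residue V) =
      (X - C (IsLocalRing.residue V ⟨x, hx⟩)) ^ Multiset.card m := by
    rw [Polynomial.map_multiset_prod, Multiset.map_map, ← Multiset.prod_replicate,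
      ← Multiset.map_const']
    refine congrArg _ (Multiset.map_congr rfl fun r hr => ?_)
    obtain ⟨_, h⟩ := hroots r (by rw [← hm]; exact Multiset.mem_map_of_mem _ hr)
    simp [← h]
  refine ⟨Multiset.card m, ?_, ?_⟩
  · rw [← Multiset.card_map ((↑) : V → F), hm, ← hsp.natDegree_eq_card_roots, natDegree_map]
    exact (minpoly.natDegree_pos hint).ne'
  · rw [← hg', lifts_iff_coeff_lifts]
    intro i
    have h1 : algebraMap E F ((minpoly E x).coeff i) = g.coeff i := by
      have := congrArg (coeff · i) hg
      simpa using this.symm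
    have h2 : algebraMap E F ((minpoly E x).coeff i) ∈ V := by rw [h1]; exact (g.coeff i).2
    refine ⟨IsLocalRing.residue _ ⟨_, h2⟩, ?_⟩
    rw [V.residueInclusion_residue E h2, coeff_map]
    exact congrArg _ (Subtype.ext h1)

/-- If the Galois group of `F/E` acts trivially on the residue field of `V` and `F` is prime-radically
closed, then so is the residue field of `V ∩ E`. -/
theorem IsPrimeRadicallyClosed.residueField_comap {E F : Type*} [Field E] [Field F] [Algebra E F]
    [Normal E F] (hF : IsPrimeRadicallyClosed F) (V : ValuationSubring F)
    (hV : ∀ (τ : F ≃ₐ[E] F) (x), τ x ∈ V ↔ x ∈ V)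
    (hτ : ∀ (τ : F ≃ₐ[E] F), ∀ x ∈ V, V.valuation (τ x - x) < 1) :
    IsPrimeRadicallyClosed (IsLocalRing.ResidueField (V.comap (algebraMap E F))) := by
  let := (V.residueInclusion E).toAlgebra
  have : IsPurelyInseparable (IsLocalRing.ResidueField (V.comap (algebraMap E F)))
      (IsLocalRing.ResidueField V) := by
    refine isPurelyInseparable_of_lifts fun x => ?_
    obtain ⟨x, hx, rfl⟩ := V.exists_residue_eq x
    exact V.X_sub_C_pow_mem_lifts hx hV fun τ => hτ τ x hx
  exact .of_isPurelyInseparable _ (IsLocalRing.ResidueField V) (hF.residueField V)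

/-- The automorphism of the residue field of `V` induced by an automorphism preserving `V`. -/
def ValuationSubring.residueEquiv {F : Type*} [Field F] (V : ValuationSubring F) (τ : F ≃+* F)
    (hτ : ∀ x, τ x ∈ V ↔ x ∈ V) :
    IsLocalRing.ResidueField V ≃+* IsLocalRing.ResidueField V :=
  IsLocalRing.ResidueField.mapEquiv
    { toFun x := ⟨τ x, (hτ x).2 x.2⟩
      invFun x := ⟨τ.symm x, (hτ _).1 (by rw [τ.apply_symm_apply]; exact x.2)⟩
      left_inv x := Subtype.ext (τ.symm_apply_apply x)
      right_inv x := Subtype.ext (τ.apply_symm_apply x)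
      map_mul' x y := Subtype.ext (map_mul τ _ _)
      map_add' x y := Subtype.ext (map_add τ _ _) }

theorem ValuationSubring.residueEquiv_residue {F : Type*} [Field F] (V : ValuationSubring F)
    (τ : F ≃+* F) (hτ : ∀ x, τ x ∈ V ↔ x ∈ V) {x : F} (hx : x ∈ V) :
    V.residueEquiv τ hτ (IsLocalRing.residue V ⟨x, hx⟩) =
      IsLocalRing.residue V ⟨τ x, (hτ x).2 hx⟩ :=
  rfl

theorem IsPrimeRadicallyClosed.valuation_sub_lt_one_of_finite {K N : Type*} [Field K] [Field N]
    [Algebra K N] [FiniteDimensional K N] [Normal K N] (hs : Group.IsSolvable (N ≃ₐ[K] N))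
    (V : ValuationSubring N) (hV : ∀ (τ : N ≃ₐ[K] N) (x), τ x ∈ V ↔ x ∈ V)
    (hk : IsPrimeRadicallyClosed (IsLocalRing.ResidueField (V.comap (algebraMap K N))))
    (τ : N ≃ₐ[K] N) {x : N} (hx : x ∈ V) : V.valuation (τ x - x) < 1 := by
  let κ := IsLocalRing.ResidueField V
  let ρ : (N ≃ₐ[K] N) →* RingAut κ := MonoidHom.mk' (fun τ => V.residueEquiv τ (hV τ)) (by
    intro σ τ
    ext y
    obtain ⟨y, hy, rfl⟩ := V.exists_residue_eq y
    rfl)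
  have hA : Group.IsSolvable ρ.range := Group.isSolvable_of_surjective ρ.rangeRestrict_surjective
  have : Finite ρ.range := Finite.of_surjective _ ρ.rangeRestrict_surjective
  let P := FixedPoints.subfield ρ.range κ
  have hmem (a) : V.residueInclusion K a ∈ P := by
    rintro ⟨_, τ, rfl⟩
    obtain ⟨a, ha, rfl⟩ := ValuationSubring.exists_residue_eq _ a
    refine congrArg (IsLocalRing.residue V) (Subtype.ext ?_)
    exact τ.commutes a
  let ι : IsLocalRing.ResidueField (V.comap (algebraMap K N)) →+* P :=
    (V.residueInclusion K).codRestrict P hmem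
  let := ι.toAlgebra
  have : IsPurelyInseparable (IsLocalRing.ResidueField (V.comap (algebraMap K N))) P := by
    refine isPurelyInseparable_of_lifts fun ⟨x, hxP⟩ => ?_
    obtain ⟨x, hx, rfl⟩ := V.exists_residue_eq x
    obtain ⟨n, hn, h⟩ := V.X_sub_C_pow_mem_lifts hx hV fun τ =>
      (V.residue_eq_residue_iff ((hV τ x).2 hx) hx).1 (hxP ⟨_, τ, rfl⟩)
    refine ⟨n, hn, ?_⟩
    rw [lifts_iff_coeff_lifts] at h ⊢
    intro i
    obtain ⟨a, ha⟩ := h i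
    refine ⟨a, Subtype.ext ?_⟩
    change V.residueInclusion K a = P.subtype _
    rw [ha, ← coeff_map]
    simp
  have hP : IsPrimeRadicallyClosed P := .of_isPurelyInseparable_bot _ _ hk
  have := IsPrimeRadicallyClosed.subsingleton_of_fixedPoints hA hP
  have h := congrArg (fun f : ρ.range => f.1 (IsLocalRing.residue V ⟨x, hx⟩))
    (Subsingleton.elim (ρ.rangeRestrict τ) 1)
  exact (V.residue_eq_residue_iff ((hV τ x).2 hx) hx).1 h

/-- If the residue field of `V ∩ K` is prime-radically closed, then the Galois group acts trivially
on the residue field of `V`. -/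
theorem IsPrimeRadicallyClosed.valuation_sub_lt_one {K S : Type*} [Field K] [Field S]
    [Algebra K S] [Normal K S] (V : ValuationSubring S)
    (hV : ∀ (τ : S ≃ₐ[K] S) (x), τ x ∈ V ↔ x ∈ V)
    (hk : IsPrimeRadicallyClosed (IsLocalRing.ResidueField (V.comap (algebraMap K S))))
    (τ : S ≃ₐ[K] S) {x : S} (hx : x ∈ V)
    (hN : ∃ N : IntermediateField K S, IsFiniteSolvableGalois K N ∧ x ∈ N) :
    V.valuation (τ x - x) < 1 := by
  obtain ⟨N, hN, hxN⟩ := hN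
  have := hN.1
  have := hN.2
  have hs := hN.3
  lift x to N using hxN
  have hV' (σ : N ≃ₐ[K] N) (y) : σ y ∈ V.comap (algebraMap N S) ↔ y ∈ V.comap (algebraMap N S) := by
    obtain ⟨σ, rfl⟩ := AlgEquiv.restrictNormalHom_surjective (K₁ := N) S σ
    rw [ValuationSubring.mem_comap, ValuationSubring.mem_comap]
    exact (AlgEquiv.restrictNormal_commutes σ N y).symm ▸ hV σ y
  have h := IsPrimeRadicallyClosed.valuation_sub_lt_one_of_finite hs (V.comap (algebraMap N S)) hV' hk
    (τ.restrictNormal N) (x := x) hx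
  have hx' := (hV' (τ.restrictNormal N) x).2 hx
  rw [← (V.comap (algebraMap N S)).residue_eq_residue_iff hx' hx] at h
  have h := congrArg (V.residueInclusion N) h
  have h := (V.residue_eq_residue_iff (x := algebraMap N S _) hx' hx).1 h
  rwa [AlgEquiv.restrictNormal_commutes] at h

end

section

open Polynomial

theorem mem_maxSolvableExt_of_tower {K : Type*} (L : Type*) {Ω : Type*} [Field K] [Field L] [Field Ω]
    [Algebra K L] [Algebra L Ω] [Algebra K Ω] [IsScalarTower K L Ω] [Normal K Ω] {x : Ω}
    (hx : x ∈ maxSolvableExt K Ω) : x ∈ maxSolvableExt L Ω := by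
  have : Normal L Ω := Normal.tower_top_of_normal K L Ω
  have hsep : IsSeparable L x := (mem_maxSolvableExt_iff.1 hx).1.tower_top L
  obtain ⟨N, hN, hxN⟩ := exists_isFiniteSolvableGalois hx
  have := hN.2
  have := hN.3
  have hsp : ((minpoly L x).map (algebraMap L Ω)).Splits := Normal.splits inferInstance x
  have hM := IntermediateField.adjoin_rootSet_isSplittingField hsp
  have hroot : ∀ y ∈ (minpoly L x).rootSet Ω, y ∈ N := by
    intro y hy
    have hy : aeval y (minpoly K x) = 0 := by
      rw [← aeval_map_algebraMap L]
      exact aeval_eq_zero_of_dvd_aeval_eq_zero (minpoly.dvd_map_of_isScalarTower K L x)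
        (mem_rootSet.1 hy).2
    obtain ⟨σ, rfl⟩ := minpoly.exists_algEquiv_of_root' (K := K) (x := y) (y := x)
      (Normal.isIntegral inferInstance x).isAlgebraic hy
    have := AlgEquiv.restrictNormal_commutes σ N ⟨x, hxN⟩
    rw [IntermediateField.algebraMap_apply, IntermediateField.algebraMap_apply] at this
    rw [← this]
    exact SetLike.coe_mem _
  set M := IntermediateField.adjoin L ((minpoly L x).rootSet Ω) with hMdef
  have hxM : x ∈ M := IntermediateField.subset_adjoin _ _ (by
    rw [mem_rootSet]
    exact ⟨minpoly.ne_zero hsep.isIntegral, minpoly.aeval L x⟩)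
  have hMG : IsGalois L M := IsGalois.of_separable_splitting_field (p := minpoly L x) hsep
  refine IsFiniteSolvableGalois.le_maxSolvableExt
    ⟨IsSplittingField.finiteDimensional M (minpoly L x), hMG, ?_⟩ hxM
  refine isSolvable_of_ker_le (G := Ω ≃ₐ[L] Ω)
    ((AlgEquiv.restrictNormalHom (F := K) (K₁ := Ω) N).comp (AlgEquiv.restrictScalarsHom K))
    (AlgEquiv.restrictNormalHom (K₁ := Ω) M) (AlgEquiv.restrictNormalHom_surjective Ω) ?_ inferInstance
  intro σ hσ
  rw [MonoidHom.mem_ker, MonoidHom.comp_apply, ← MonoidHom.mem_ker,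
    IntermediateField.restrictNormalHom_ker] at hσ
  rw [IntermediateField.restrictNormalHom_ker, IntermediateField.mem_fixingSubgroup_iff]
  intro y hy
  induction hy using IntermediateField.adjoin_induction with
  | mem y hy => exact (IntermediateField.mem_fixingSubgroup_iff _ _).1 hσ y (hroot y hy)
  | algebraMap y => exact σ.commutes y
  | add y z _ _ hy hz => rw [map_add, hy, hz]
  | mul y z _ _ hy hz => rw [map_mul, hy, hz]
  | inv y _ hy => rw [map_inv₀, hy]

theorem map_mem_maxSolvableExt {K Ω Ω' : Type*} [Field K] [Field Ω] [Field Ω']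
    [Algebra K Ω] [Algebra K Ω'] [Normal K Ω] [Normal K Ω'] (f : Ω →ₐ[K] Ω') {x : Ω}
    (hx : x ∈ maxSolvableExt K Ω) : f x ∈ maxSolvableExt K Ω' := by
  rw [mem_maxSolvableExt_iff, IsSeparable, minpoly.algHom_eq f f.injective] at *
  exact hx

theorem exists_algHom_solvClosure (K : Type*) [Field K] (L : Type*) [Field L] [Algebra K L]
    [Algebra.IsAlgebraic K L]
    [Algebra L (AlgebraicClosure K)] [IsScalarTower K L (AlgebraicClosure K)] :
    ∃ f : AlgebraicClosure K →ₐ[L] AlgebraicClosure L,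
      ∀ x ∈ solvClosure K, f x ∈ solvClosure L := by
  have : Algebra.IsAlgebraic L (AlgebraicClosure K) := .tower_top (K := K) L
  have : IsAlgClosure K (AlgebraicClosure L) := ⟨inferInstance, .trans K L _⟩
  have : Normal K (AlgebraicClosure L) := IsAlgClosure.normal K _
  let f : AlgebraicClosure K →ₐ[L] AlgebraicClosure L := IsAlgClosed.lift
  exact ⟨f, fun x hx => mem_maxSolvableExt_of_tower L
    (map_mem_maxSolvableExt (f.restrictScalars K) hx)⟩

end

section Stable

variable {K S : Type*} [Field K] [Field S] [Algebra K S] [Normal K S]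

theorem exists_iterate_eq (σ : S ≃ₐ[K] S) (x : S) : ∃ n ≠ 0, σ^[n] x = x := by
  have hmem (n : ℕ) : σ^[n] x ∈ (minpoly K x).rootSet S := by
    rw [Polynomial.mem_rootSet]
    refine ⟨minpoly.ne_zero (Normal.isIntegral inferInstance x), ?_⟩
    rw [← AlgEquiv.coe_pow, Polynomial.aeval_algHom_apply, minpoly.aeval, map_zero]
  obtain ⟨m, n, hmn, h⟩ :=
    Finite.exists_ne_map_eq_of_infinite (fun n => (⟨_, hmem n⟩ : (minpoly K x).rootSet S))
  have h : σ^[m] x = σ^[n] x := congrArg Subtype.val h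
  rcases lt_or_gt_of_ne hmn with hlt | hlt
  · exact ⟨n - m, by lia, Function.iterate_cancel σ.injective h.symm⟩
  · exact ⟨m - n, by lia, Function.iterate_cancel σ.injective h⟩

namespace ValuationSubring

theorem mem_iff_of_forall_mem {V : ValuationSubring S} {σ : S ≃ₐ[K] S} (h : ∀ x ∈ V, σ x ∈ V)
    (x : S) : σ x ∈ V ↔ x ∈ V := by
  refine ⟨fun hx => ?_, h x⟩
  obtain ⟨n, hn, hn'⟩ := exists_iterate_eq σ x
  obtain ⟨n, rfl⟩ := Nat.exists_eq_succ_of_ne_zero hn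
  rw [← hn', Function.iterate_succ_apply]
  clear hn hn'
  induction n with
  | zero => exact hx
  | succ n ih =>
    rw [Function.iterate_succ_apply']
    exact h _ ih

theorem mem_iff_of_forall_mem_symm {V : ValuationSubring S} {σ : S ≃ₐ[K] S}
    (h : ∀ x, σ x ∈ V → x ∈ V) (x : S) : σ x ∈ V ↔ x ∈ V := by
  have := mem_iff_of_forall_mem (σ := σ.symm) (V := V)
    (fun x hx => h _ (by rwa [AlgEquiv.apply_symm_apply])) (σ x)
  rw [AlgEquiv.symm_apply_apply] at this
  exact this.symm

/-- An overring `W` of a valuation ring `U` is preserved by `σ` if `σ U ⊆ W`. -/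
theorem mem_iff_of_le {U W : ValuationSubring S} {σ : S ≃ₐ[K] S} (hU : U ≤ W)
    (hσ : ∀ x ∈ U, σ x ∈ W) (x : S) : σ x ∈ W ↔ x ∈ W := by
  let W' : ValuationSubring S := W.comap (σ : S →+* S)
  rcases le_total (⟨W, hU⟩ : {A // U ≤ A}) ⟨W', hσ⟩ with h | h
  · exact mem_iff_of_forall_mem h x
  · exact mem_iff_of_forall_mem_symm h x

end ValuationSubring

end Stable

namespace ValuationSubring

variable {F : Type*} [Field F]

/-- The smallest valuation ring containing two valuation rings, as the set of products. -/
def mulSup (V V' : ValuationSubring F) : ValuationSubring F where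
  carrier := {z | ∃ v ∈ V, ∃ v' ∈ V', z = v * v'}
  mul_mem' := by
    rintro _ _ ⟨a, ha, a', ha', rfl⟩ ⟨b, hb, b', hb', rfl⟩
    exact ⟨a * b, MulMemClass.mul_mem ha hb, a' * b', MulMemClass.mul_mem ha' hb', by ring⟩
  one_mem' := ⟨1, OneMemClass.one_mem _, 1, OneMemClass.one_mem _, by ring⟩
  zero_mem' := ⟨1, OneMemClass.one_mem _, 0, ZeroMemClass.zero_mem _, by ring⟩
  add_mem' := by
    have key : ∀ a ∈ V, ∀ a' ∈ V', ∀ y : F, y / (a * a') ∈ V →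
        a * a' ≠ 0 → ∃ v ∈ V, ∃ v' ∈ V', a * a' + y = v * v' := by
      intro a ha a' ha' y hy h0
      exact ⟨a * (1 + y / (a * a')),
        MulMemClass.mul_mem ha (AddMemClass.add_mem (OneMemClass.one_mem _) hy), a', ha', by
        rw [mul_right_comm, mul_add, mul_one, mul_div_cancel₀ _ h0]⟩
    rintro _ _ ⟨a, ha, a', ha', rfl⟩ ⟨b, hb, b', hb', rfl⟩
    by_cases h0 : a * a' = 0
    · exact ⟨b, hb, b', hb', by rw [h0, zero_add]⟩
    by_cases h0' : b * b' = 0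
    · exact ⟨a, ha, a', ha', by rw [h0', add_zero]⟩
    rcases V.mem_or_inv_mem (b * b' / (a * a')) with h | h
    · exact key a ha a' ha' _ h h0
    · rw [inv_div] at h
      obtain ⟨v, hv, v', hv', h⟩ := key b hb b' hb' _ h h0'
      exact ⟨v, hv, v', hv', by rw [← h, add_comm]⟩
  neg_mem' := by
    rintro _ ⟨a, ha, a', ha', rfl⟩
    exact ⟨-a, NegMemClass.neg_mem ha, a', ha', by ring⟩
  mem_or_inv_mem' x := by
    rcases V.mem_or_inv_mem x with h | h
    · exact .inl ⟨x, h, 1, OneMemClass.one_mem _, by ring⟩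
    · exact .inr ⟨_, h, 1, OneMemClass.one_mem _, by ring⟩

theorem le_mulSup_left (V V' : ValuationSubring F) : V ≤ mulSup V V' :=
  fun x hx => ⟨x, hx, 1, one_mem _, by ring⟩

theorem le_mulSup_right (V V' : ValuationSubring F) : V' ≤ mulSup V V' :=
  fun x hx => ⟨1, one_mem _, x, hx, by ring⟩

theorem valuation_lt_one_of_le {V W : ValuationSubring F} (h : V ≤ W) {x : F}
    (hx : W.valuation x < 1) : V.valuation x < 1 := by
  by_contra! hx1
  rcases eq_or_ne x 0 with rfl | hx0
  · simp at hx1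
  have h1 : x⁻¹ ∈ V := by
    rw [← V.valuation_le_one_iff, map_inv₀]
    exact inv_le_one_of_one_le₀ hx1
  have h2 := (W.valuation_le_one_iff _).2 (h h1)
  rw [map_inv₀, inv_le_one₀ (by simpa [zero_lt_iff] using hx0)] at h2
  exact hx.not_ge h2

/-- The valuation ring of the residue field of `W` induced by a valuation ring `V ≤ W`. -/
def residueImage {V W : ValuationSubring F} (h : V ≤ W) :
    ValuationSubring (IsLocalRing.ResidueField W) where
  toSubring := (V.toSubring.comap W.subtype).map (IsLocalRing.residue W)
  mem_or_inv_mem' a := by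
    obtain ⟨x, hx, rfl⟩ := W.exists_residue_eq a
    rcases V.mem_or_inv_mem x with hxV | hxV
    · exact .inl ⟨⟨x, hx⟩, hxV, rfl⟩
    · right
      rcases eq_or_ne x 0 with rfl | hx0
      · refine ⟨0, zero_mem _, ?_⟩
        rw [map_zero, eq_comm, inv_eq_zero]
        exact map_zero _
      · refine ⟨⟨x⁻¹, h hxV⟩, hxV, ?_⟩
        rw [eq_comm, inv_eq_iff_eq_inv, eq_comm, inv_eq_of_mul_eq_one_left]
        rw [← map_mul, ← map_one (IsLocalRing.residue W)]
        exact congrArg _ (Subtype.ext (mul_inv_cancel₀ hx0))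

theorem residue_mem_residueImage_iff {V W : ValuationSubring F} (h : V ≤ W) {x : F} (hx : x ∈ W) :
    IsLocalRing.residue W ⟨x, hx⟩ ∈ residueImage h ↔ x ∈ V := by
  refine ⟨?_, fun hxV => ⟨⟨x, hx⟩, hxV, rfl⟩⟩
  rintro ⟨⟨y, hy⟩, hyV, hxy⟩
  have hyV : y ∈ V := hyV
  have h1 := valuation_lt_one_of_le h ((W.residue_eq_residue_iff hy hx).1 hxy)
  have h2 : y - x ∈ V := (V.valuation_le_one_iff _).1 h1.le
  simpa using sub_mem hyV h2

theorem residueImage_ne_top {V W : ValuationSubring F} (h : V ≤ W) (hW : ¬ W ≤ V) :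
    residueImage h ≠ ⊤ := by
  intro htop
  refine hW fun x hx => (residue_mem_residueImage_iff h hx).1 ?_
  rw [htop]
  exact mem_top _

theorem residueEquiv_iterate_residue (V : ValuationSubring F) (τ : F ≃+* F)
    (hτ : ∀ x, τ x ∈ V ↔ x ∈ V) {x : F} (hx : x ∈ V) (n : ℕ) :
    (V.residueEquiv τ hτ)^[n] (IsLocalRing.residue V ⟨x, hx⟩) =
      IsLocalRing.residue V ⟨τ^[n] x, (iterate_mem_iff hτ n x).2 hx⟩ := by
  induction n generalizing x with
  | zero => rfl
  | succ n ih =>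
    simp only [Function.iterate_succ_apply]
    rw [V.residueEquiv_residue τ hτ hx, ih]

end ValuationSubring

section Conjugates

variable {K S : Type*} [Field K] [Field S] [Algebra K S]

open IsLocalRing in
/-- An automorphism acting with finite order on the residue field of `W` and fixing a square root
of `-1` there acts trivially. -/
theorem IsPrimeRadicallyClosed.valuation_sub_lt_one_of_iterate (hS : IsPrimeRadicallyClosed S)
    (W : ValuationSubring S) (g : S ≃+* S) (hg : ∀ x, g x ∈ W ↔ x ∈ W)
    {n : ℕ} (hn : n ≠ 0) (hgn : ∀ x ∈ W, W.valuation (g^[n] x - x) < 1)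
    {i : ResidueField W} (hi : i ^ 2 = -1) (hgi : W.residueEquiv g hg i = i)
    {x : S} (hx : x ∈ W) : W.valuation (g x - x) < 1 := by
  rw [← W.residue_eq_residue_iff ((hg x).2 hx) hx, ← W.residueEquiv_residue g hg hx]
  refine (hS.residueField W).eq_one_of_pow_eq_one hn (fun a => ?_) hi hgi _
  obtain ⟨y, hy, rfl⟩ := W.exists_residue_eq a
  rw [W.residueEquiv_iterate_residue g hg hy, W.residue_eq_residue_iff]
  exact hgn y hy

open IsLocalRing ValuationSubring in
theorem IsPrimeRadicallyClosed.valuation_mulSup_sub_lt_one [Normal K S]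
    (hS : IsPrimeRadicallyClosed S)
    {V V' : ValuationSubring S} (hV : ¬ V ≤ V') (hV' : ¬ V' ≤ V) (τ : S ≃ₐ[K] S)
    (hτV : ∀ x, τ x ∈ V ↔ x ∈ V) (hτV' : ∀ x, τ x ∈ V' ↔ x ∈ V')
    {x : S} (hx : x ∈ mulSup V V') : (mulSup V V').valuation (τ x - x) < 1 := by
  set W := mulSup V V'
  have hl : V ≤ W := le_mulSup_left V V'
  have hr : V' ≤ W := le_mulSup_right V V'
  have hτW : ∀ x, (τ : S ≃+* S) x ∈ W ↔ x ∈ W :=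
    mem_iff_of_le hl fun x hx => hl ((hτV x).2 hx)
  have key := (hS.residueField W).map_eq_self_of_independent
    (V := residueImage hl) (V' := residueImage hr)
    (residueImage_ne_top hl fun h => hV' (hr.trans h))
    (residueImage_ne_top hr fun h => hV (hl.trans h))
    (by
      intro z
      obtain ⟨y, ⟨v, hv, v', hv', rfl⟩, rfl⟩ := W.exists_residue_eq z
      exact ⟨_, (residue_mem_residueImage_iff hl (hl hv)).2 hv,
        _, (residue_mem_residueImage_iff hr (hr hv')).2 hv', map_mul (residue W) ⟨v, _⟩ ⟨v', _⟩⟩)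
    (τ := W.residueEquiv τ hτW)
    (by
      intro a
      obtain ⟨y, hy, rfl⟩ := W.exists_residue_eq a
      rw [W.residueEquiv_residue, residue_mem_residueImage_iff, residue_mem_residueImage_iff]
      exact hτV y)
    (by
      intro a
      obtain ⟨y, hy, rfl⟩ := W.exists_residue_eq a
      rw [W.residueEquiv_residue, residue_mem_residueImage_iff, residue_mem_residueImage_iff]
      exact hτV' y)
    (by
      intro a
      obtain ⟨y, hy, rfl⟩ := W.exists_residue_eq a
      obtain ⟨n, hn, h⟩ := exists_iterate_eq τ y
      refine ⟨n, hn, ?_⟩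
      rw [W.residueEquiv_iterate_residue]
      exact congrArg _ (Subtype.ext h))
    (residue W ⟨x, hx⟩)
  rwa [W.residueEquiv_residue, residue_eq_residue_iff] at key

open IsLocalRing ValuationSubring in
/-- If a finite index group of automorphisms stabilizes `V` and acts nontrivially on its residue
field, then every automorphism stabilizes `V`. -/
theorem IsPrimeRadicallyClosed.map_mem_iff_of_finiteIndex [Normal K S]
    (hS : IsPrimeRadicallyClosed S) (V : ValuationSubring S) (H : Subgroup (S ≃ₐ[K] S))
    [H.FiniteIndex] (hH : ∀ τ ∈ H, ∀ x, τ x ∈ V ↔ x ∈ V)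
    (hne : ∃ d ∈ H, ∃ x ∈ V, ¬ V.valuation (d x - x) < 1) (σ : S ≃ₐ[K] S) (x : S) :
    σ x ∈ V ↔ x ∈ V := by
  by_contra hx
  let V' : ValuationSubring S := V.comap (σ : S →+* S)
  have hVV' : ¬ V ≤ V' := fun h => hx (mem_iff_of_forall_mem h x)
  have hV'V : ¬ V' ≤ V := fun h => hx (mem_iff_of_forall_mem_symm h x)
  let W := mulSup V V'
  have hl : V ≤ W := le_mulSup_left V V'
  have hr : V' ≤ W := le_mulSup_right V V'
  have hCW {τ : S ≃ₐ[K] S} (hτ : τ ∈ H.normalCore) {x : S} (hx : x ∈ W) :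
      W.valuation (τ x - x) < 1 := by
    refine hS.valuation_mulSup_sub_lt_one hVV' hV'V τ (hH τ (H.normalCore_le hτ)) (fun y => ?_) hx
    have h := hH _ (H.normalCore_le (H.normalCore_normal.conj_mem τ hτ σ)) (σ y)
    change σ (τ y) ∈ V ↔ σ y ∈ V
    simpa [AlgEquiv.mul_apply] using h
  have hσW : ∀ x, (σ : S ≃+* S) x ∈ W ↔ x ∈ W := mem_iff_of_le hr fun x hx => hl hx
  have hHW {h : S ≃ₐ[K] S} (hh : h ∈ H) : ∀ x, (h : S ≃+* S) x ∈ W ↔ x ∈ W :=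
    mem_iff_of_le hl fun x hx => hl ((hH h hh x).2 hx)
  obtain ⟨i, hi⟩ : ∃ i : ResidueField W, i ^ 2 = -1 := by
    by_cases h2 : ((2 : ℕ) : ResidueField W) = 0
    · refine ⟨1, ?_⟩
      push_cast at h2
      linear_combination h2
    · exact (hS.residueField W).exists_pow_eq 2 Nat.prime_two h2 (-1)
  have key (g : S ≃ₐ[K] S) (hg : ∀ x, (g : S ≃+* S) x ∈ W ↔ x ∈ W)
      (hgi : W.residueEquiv g hg i = i) {x : S} (hx : x ∈ W) : W.valuation (g x - x) < 1 := by
    obtain ⟨n, hn, -, hgn⟩ := Subgroup.exists_pow_mem_of_index_ne_zero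
      (Subgroup.FiniteIndex.index_ne_zero (H := H.normalCore)) g
    refine hS.valuation_sub_lt_one_of_iterate W g hg hn.ne' (fun x hx => ?_) hi hgi hx
    have := hCW hgn hx
    rwa [AlgEquiv.coe_pow] at this
  have key' (g : S ≃ₐ[K] S) (hg : ∀ x, (g : S ≃+* S) x ∈ W ↔ x ∈ W)
      (hgi : W.residueEquiv g hg i = i) {x : S} (hx : x ∈ V) : g x ∈ V := by
    have h := key g hg hgi (hl hx)
    have h' := (V.valuation_le_one_iff _).1 (valuation_lt_one_of_le hl h).le
    simpa using add_mem h' hx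
  have hsq (g : S ≃ₐ[K] S) (hg : ∀ x, (g : S ≃+* S) x ∈ W ↔ x ∈ W) :
      W.residueEquiv g hg i = i ∨ W.residueEquiv g hg i = -i := by
    rw [← sq_eq_sq_iff_eq_or_eq_neg, ← map_pow, hi, map_neg, map_one]
  have hσi : W.residueEquiv σ hσW i = -i :=
    (hsq σ hσW).resolve_left fun h => hVV' fun x hx => key' σ hσW h hx
  obtain ⟨d, hd, y, hy, hdy⟩ := hne
  have hdi : W.residueEquiv d (hHW hd) i = -i :=
    (hsq d (hHW hd)).resolve_left fun h =>
      hdy (valuation_lt_one_of_le hl (key d (hHW hd) h (hl hy)))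
  have hσdW : ∀ x, ((σ * d : S ≃ₐ[K] S) : S ≃+* S) x ∈ W ↔ x ∈ W := fun x =>
    (hσW (d x)).trans (hHW hd x)
  have hσdi : W.residueEquiv ((σ * d : S ≃ₐ[K] S) : S ≃+* S) hσdW i = i := by
    have : W.residueEquiv ((σ * d : S ≃ₐ[K] S) : S ≃+* S) hσdW i =
        W.residueEquiv σ hσW (W.residueEquiv d (hHW hd) i) := by
      obtain ⟨y, hy, rfl⟩ := W.exists_residue_eq i
      rw [W.residueEquiv_residue, W.residueEquiv_residue, W.residueEquiv_residue]
      rfl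
    rw [this, hdi, map_neg, hσi, neg_neg]
  refine hVV' fun x hx => ?_
  have hx' : d (d⁻¹ x) = x := AlgEquiv.apply_symm_apply d x
  have := key' _ hσdW hσdi (x := d⁻¹ x) ((hH d hd _).1 (by rwa [hx']))
  rwa [AlgEquiv.mul_apply, hx'] at this

end Conjugates

section Comap

variable {K S : Type*} [Field K] [Field S] [Algebra K S] [Normal K S]

open Polynomial

theorem ValuationSubring.algebraMap_coeff_minpoly_mem (V : ValuationSubring S)
    (hV : ∀ (τ : S ≃ₐ[K] S) (x), τ x ∈ V ↔ x ∈ V) {x : S} (hx : x ∈ V) (i : ℕ) :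
    algebraMap K S ((minpoly K x).coeff i) ∈ V := by
  have hint : IsIntegral K x := Normal.isIntegral inferInstance x
  have hsp : ((minpoly K x).map (algebraMap K S)).Splits := Normal.splits inferInstance x
  obtain ⟨m, hm⟩ : ∃ m : Multiset V, m.map (↑) = ((minpoly K x).map (algebraMap K S)).roots := by
    refine CanLift.prf _ fun r hr => ?_
    rw [mem_roots_map (minpoly.ne_zero hint)] at hr
    obtain ⟨τ, rfl⟩ := minpoly.exists_algEquiv_of_root' (K := K) (x := r) (y := x)
      hint.isAlgebraic hr
    exact (hV τ x).2 hx
  have hg : ((m.map fun r => X - C r).prod).map V.subtype =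
      (minpoly K x).map (algebraMap K S) := by
    rw [hsp.eq_prod_roots_of_monic ((minpoly.monic hint).map _), ← hm, Polynomial.map_multiset_prod,
      Multiset.map_map, Multiset.map_map]
    simp
  rw [← coeff_map, ← hg, coeff_map]
  exact Subtype.prop _

theorem ValuationSubring.le_of_comap_le {V V₂ : ValuationSubring S}
    (hV : ∀ (τ : S ≃ₐ[K] S) (x), τ x ∈ V ↔ x ∈ V)
    (h : V.comap (algebraMap K S) ≤ V₂.comap (algebraMap K S)) : V ≤ V₂ := by
  intro x hx
  have hint : IsIntegral K x := Normal.isIntegral inferInstance x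
  refine V₂.mem_of_pow_eq_sum (n := (minpoly K x).natDegree)
    (c := fun i => - algebraMap K S ((minpoly K x).coeff i))
    (fun i _ => NegMemClass.neg_mem (h (V.algebraMap_coeff_minpoly_mem hV hx i))) ?_
  have h0 := minpoly.aeval K x
  rw [aeval_eq_sum_range, Finset.sum_range_succ, coeff_natDegree, minpoly.monic hint,
    one_smul] at h0
  simp only [neg_mul, Finset.sum_neg_distrib, ← Algebra.smul_def]
  exact eq_neg_of_add_eq_zero_right h0

theorem ValuationSubring.eq_of_comap_eq {V V₂ : ValuationSubring S}
    (hV : ∀ (τ : S ≃ₐ[K] S) (x), τ x ∈ V ↔ x ∈ V)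
    (h : V₂.comap (algebraMap K S) = V.comap (algebraMap K S)) : V₂ = V := by
  have hle : V ≤ V₂ := le_of_comap_le hV h.ge
  exact le_antisymm
    (le_of_comap_le (fun τ => mem_iff_of_le hle fun x hx => hle ((hV τ x).2 hx)) h.le) hle

end Comap

theorem mem_maxSolvableExt_self {K Ω : Type*} [Field K] [Field Ω] [Algebra K Ω] [Normal K Ω]
    (x : maxSolvableExt K Ω) : x ∈ maxSolvableExt K (maxSolvableExt K Ω) := by
  have h := mem_maxSolvableExt_iff.1 x.2
  have hx : minpoly K (x : Ω) = minpoly K x :=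
    minpoly.algebraMap_eq (algebraMap (maxSolvableExt K Ω) Ω).injective x
  rwa [IsSeparable, hx, ← IsSeparable, ← mem_maxSolvableExt_iff] at h

theorem ValuationSubring.exists_comap_eq_of_existsUnique {L S T : Type*} [Field L] [Field S]
    [Field T] [Algebra L S] [Algebra L T] [Normal L S] [Normal L T] (j : S →ₐ[L] T)
    {O : ValuationSubring L} (hO : ∃! V : ValuationSubring T, V.comap (algebraMap L T) = O) :
    ∃ V : ValuationSubring S, V.comap (algebraMap L S) = O ∧
      ∀ (τ : S ≃ₐ[L] S) (x), τ x ∈ V ↔ x ∈ V := by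
  obtain ⟨V, hV, huniq⟩ := hO
  refine ⟨V.comap (j : S →+* T), ?_, fun τ x => ?_⟩
  · rw [comap_comap, AlgHom.comp_algebraMap, hV]
  let := j.toRingHom.toAlgebra
  have : IsScalarTower L S T := .of_algebraMap_eq fun x => (j.commutes x).symm
  let τ' : T ≃ₐ[L] T := τ.liftNormal T
  have hτ' (y : S) : τ' (j y) = j (τ y) := τ.liftNormal_commutes T y
  have h : V.comap (τ' : T →+* T) = V := huniq _ (by
    change (V.comap (τ' : T →+* T)).comap (algebraMap L T) = O
    rw [comap_comap, ← hV]
    congr 1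
    ext y
    exact τ'.commutes y)
  change j (τ x) ∈ V ↔ j x ∈ V
  rw [← hτ']
  change j x ∈ V.comap (τ' : T →+* T) ↔ _
  rw [h]

theorem finiteIndex_range_restrictScalarsHom (K : Type*) {L S : Type*} [Field K] [Field L] [Field S]
    [Algebra K L] [Algebra K S] [Algebra L S] [IsScalarTower K L S] [FiniteDimensional K L]
    [IsGalois K S] :
    (AlgEquiv.restrictScalarsHom K : (S ≃ₐ[L] S) →* (S ≃ₐ[K] S)).range.FiniteIndex := by
  let F : IntermediateField K S := (IsScalarTower.toAlgHom K L S).fieldRange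
  have : FiniteDimensional K F :=
    (AlgEquiv.ofInjectiveField (IsScalarTower.toAlgHom K L S)).toLinearEquiv.finiteDimensional
  have : F.fixingSubgroup.FiniteIndex := ⟨by
    rw [← IntermediateField.finrank_eq_fixingSubgroup_index]
    exact Module.finrank_pos.ne'⟩
  refine Subgroup.finiteIndex_of_le (H := F.fixingSubgroup) fun σ hσ => ?_
  refine ⟨AlgEquiv.ofRingEquiv (f := (σ : S ≃+* S)) fun x => ?_, rfl⟩
  exact (IntermediateField.mem_fixingSubgroup_iff _ _).1 hσ _ ⟨x, rfl⟩

theorem IsPrimeRadicallyClosed.map_mem_iff_of_tower {K L S : Type*} [Field K] [Field L] [Field S]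
    [Algebra K L] [Algebra K S] [Algebra L S] [IsScalarTower K L S] [FiniteDimensional K L]
    [IsGalois K S] (hS : IsPrimeRadicallyClosed S) {V : ValuationSubring S}
    (hV : ∀ (τ : S ≃ₐ[L] S) (x), τ x ∈ V ↔ x ∈ V)
    (hne : ∃ d : S ≃ₐ[L] S, ∃ x ∈ V, ¬ V.valuation (d x - x) < 1) (σ : S ≃ₐ[K] S) (x : S) :
    σ x ∈ V ↔ x ∈ V := by
  have := finiteIndex_range_restrictScalarsHom K (L := L) (S := S)
  obtain ⟨d, hd⟩ := hne
  refine hS.map_mem_iff_of_finiteIndex V (AlgEquiv.restrictScalarsHom K).range ?_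
    ⟨_, ⟨d, rfl⟩, hd⟩ σ x
  rintro _ ⟨τ, rfl⟩
  exact hV τ

/-- Let `L ⊆ K^solv` be finite over `K`. If `O'` is a solv-henselian
valuation ring of `L` with non-solv-closed residue field, then `O' ∩ K` is a solv-henselian
valuation ring of `K` with non-solv-closed residue field. -/
theorem statement_16 (K : Type) [Field K]
    (L : IntermediateField K (AlgebraicClosure K)) (hL : L ≤ solvClosure K)
    (hfin : FiniteDimensional K ↥L)
    (O' : ValuationSubring ↥L) (h1 : IsSolvHenselian O')
    (h2 : ¬ IsSolvClosed (IsLocalRing.ResidueField ↥O')) :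
    IsSolvHenselian (O'.comap (algebraMap K ↥L)) ∧
    ¬ IsSolvClosed (IsLocalRing.ResidueField ↥(O'.comap (algebraMap K ↥L))) := by
  let S := solvClosure K
  let : Algebra L S := (IntermediateField.inclusion hL).toRingHom.toAlgebra
  have : IsScalarTower K L S := .of_algebraMap_eq fun _ => rfl
  have : IsScalarTower L S (AlgebraicClosure K) := .of_algebraMap_eq fun _ => rfl
  have hSG : IsGalois K S := isGalois_maxSolvableExt
  have : Normal L S := Normal.tower_top_of_normal K L S
  have hS : IsPrimeRadicallyClosed S := .maxSolvableExt K _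
  have : Normal L (solvClosure L) := isGalois_maxSolvableExt.to_normal
  obtain ⟨f, hf⟩ := exists_algHom_solvClosure K L
  let j : S →ₐ[L] solvClosure L :=
    { toFun x := ⟨f x, hf x x.2⟩
      map_one' := Subtype.ext (map_one f)
      map_mul' x y := Subtype.ext (map_mul f _ _)
      map_zero' := Subtype.ext (map_zero f)
      map_add' x y := Subtype.ext (map_add f _ _)
      commutes' x := Subtype.ext (f.commutes x) }
  obtain ⟨V, hVO, hV⟩ := ValuationSubring.exists_comap_eq_of_existsUnique j h1
  have hne : ∃ d : S ≃ₐ[L] S, ∃ x ∈ V, ¬ V.valuation (d x - x) < 1 := by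
    by_contra! h
    subst hVO
    exact h2 (hS.residueField_comap V hV h).isSolvClosed
  have hVK := hS.map_mem_iff_of_tower (K := K) hV hne
  have hO : O'.comap (algebraMap K L) = V.comap (algebraMap K S) := by
    rw [← hVO, ValuationSubring.comap_comap]
    rfl
  rw [hO]
  refine ⟨⟨V, rfl, fun V₂ h => ValuationSubring.eq_of_comap_eq hVK h⟩, fun hk => ?_⟩
  obtain ⟨d, x, hx, hdx⟩ := hne
  exact hdx (IsPrimeRadicallyClosed.valuation_sub_lt_one V hVK hk.isPrimeRadicallyClosed
    (d.restrictScalars K) hx (exists_isFiniteSolvableGalois (mem_maxSolvableExt_self x)))
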